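/- arXiv:cs/0511030 — 4 statements merged into one kernel-verified Lean document; each statement's English description precedes it below -/
import Mathlib

section
/- Let G be a connected graph, k ≥ ola⁺(G) a positive integer, α an optimal (minimum net cost) linear arrangement of G, and e a k-separating bridge of G with components G₁,G₂ of G−e. Then G₁ and G₂ are α-comparable: either α(a) < α(b) for all a∈V(G₁), b∈V(G₂), or α(a) > α(b) for all such a,b. -/
open scoped BigOperators

/-- The length of an edge (as an unordered pair) under a labelling `α`. -/
noncomputable def edgeLen {V : Type*} (α : V → ℕ) : Sym2 V → ℕ :=
  Sym2.lift ⟨fun u v => ((α u : ℤ) - (α v : ℤ)).natAbs,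
    fun u v => by simp only []; rw [show (α u:ℤ) - α v = -((α v:ℤ) - α u) by ring, Int.natAbs_neg]⟩

/-- The net cost of a labelling `α` of the graph `G`. -/
noncomputable def netCost {V : Type*} (G : SimpleGraph V) (α : V → ℕ) : ℕ :=
  ∑ᶠ e ∈ G.edgeSet, (edgeLen α e - 1)

/-- A linear arrangement of `G`, viewed as map to `{1, …, n}`. -/
noncomputable def arr {V : Type*} [Finite V] (α : V ≃ Fin (Nat.card V)) (v : V) : ℕ :=
  (α v : ℕ) + 1

/-- `ola⁺(G)`: minimum net cost of a linear arrangement of `G`. -/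
noncomputable def olaPlus {V : Type*} [Finite V] (G : SimpleGraph V) : ℕ :=
  sInf {c : ℕ | ∃ α : V ≃ Fin (Nat.card V), netCost G (arr α) = c}

/-- An edge `s(u,v)` is a `k`-separating bridge of `G` if it is a bridge and both
connected components of `G − e` have more than `k` vertices. -/
def IsKSepBridge {V : Type*} (G : SimpleGraph V) (k : ℕ) (u v : V) : Prop :=
  G.IsBridge s(u, v) ∧
    k < Nat.card ((G.deleteEdges {s(u, v)}).connectedComponentMk u).supp ∧
    k < Nat.card ((G.deleteEdges {s(u, v)}).connectedComponentMk v).supp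

open scoped Classical in
/-- The set of edges of `G` passing strictly over the vertex `w` in the arrangement `α`. -/
noncomputable def edgesOver {V : Type*} [Fintype V] {n : ℕ} (G : SimpleGraph V) (α : V → Fin n)
    (w : V) : Finset (Sym2 V) :=
  {e ∈ G.edgeFinset | ∃ x ∈ e, ∃ y ∈ e, α x < α w ∧ α w < α y}

theorem mem_edgesOver {V : Type*} [Fintype V] {n : ℕ} {G : SimpleGraph V} {α : V → Fin n}
    {w x y : V} : s(x, y) ∈ edgesOver G α w ↔
      G.Adj x y ∧ (α x < α w ∧ α w < α y ∨ α y < α w ∧ α w < α x) := by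
  classical
  simp only [edgesOver, Finset.mem_filter, SimpleGraph.mem_edgeFinset, SimpleGraph.mem_edgeSet,
    Sym2.mem_iff, exists_eq_or_imp, exists_eq_left]
  grind

open scoped Classical in
theorem edgeLen_arr_sub_one {V : Type*} [Fintype V] (α : V ≃ Fin (Nat.card V)) (e : Sym2 V) :
    edgeLen (arr α) e - 1 =
      (Finset.univ.filter fun w => ∃ x ∈ e, ∃ y ∈ e, α x < α w ∧ α w < α y).card := by
  induction e with | _ x y
  have h : (Finset.univ.filter fun w => ∃ a ∈ s(x, y), ∃ b ∈ s(x, y), α a < α w ∧ α w < α b) =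
      (Finset.Ioo (min (α x) (α y)) (max (α x) (α y))).map α.symm.toEmbedding := by
    ext w
    simp only [Finset.mem_filter, Finset.mem_univ, true_and, Sym2.mem_iff, exists_eq_or_imp,
      exists_eq_left, Finset.mem_map_equiv, Equiv.symm_symm, Finset.mem_Ioo, min_lt_iff,
      lt_max_iff]
    grind
  rw [h, Finset.card_map, Fin.card_Ioo]
  simp only [edgeLen, arr, Sym2.lift_mk]
  rcases le_total (α x) (α y) with hxy | hxy
  · rw [min_eq_left hxy, max_eq_right hxy]
    omega
  · rw [min_eq_right hxy, max_eq_left hxy]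
    omega

theorem netCost_arr_eq_sum {V : Type*} [Fintype V] (G : SimpleGraph V)
    (α : V ≃ Fin (Nat.card V)) :
    netCost G (arr α) = ∑ w, (edgesOver G α w).card := by
  classical
  have h : netCost G (arr α) = ∑ e ∈ G.edgeFinset, (edgeLen (arr α) e - 1) := by
    rw [netCost, ← SimpleGraph.coe_edgeFinset, finsum_mem_coe_finset]
  rw [h, Finset.sum_congr rfl fun e _ => edgeLen_arr_sub_one α e]
  refine (Finset.sum_card_bipartiteAbove_eq_sum_card_bipartiteBelow
    (s := G.edgeFinset) (t := Finset.univ)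
    (fun (e : Sym2 V) w => ∃ x ∈ e, ∃ y ∈ e, α x < α w ∧ α w < α y)).trans ?_
  refine Finset.sum_congr rfl fun w _ => ?_
  unfold edgesOver Finset.bipartiteBelow
  congr!

theorem exists_arrangement_lt_iff {V : Type*} [Fintype V] {g : V → ℕ}
    (hg : Function.Injective g) :
    ∃ β : V ≃ Fin (Nat.card V), ∀ x y, β x < β y ↔ g x < g y := by
  let _ : LinearOrder V := LinearOrder.lift' g hg
  have e := Fintype.orderIsoFinOfCardEq V (Nat.card_eq_fintype_card (α := V)).symm
  exact ⟨e.symm.toEquiv, fun x y => e.symm.lt_iff_lt⟩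

theorem exists_adj_over_of_reachable {V : Type*} {n : ℕ} {H : SimpleGraph V}
    {α : V ≃ Fin n} {a b w : V} (hab : H.Reachable a b) (hw : ¬ H.Reachable a w)
    (haw : α a < α w) (hwb : α w < α b) :
    ∃ x y, H.Adj x y ∧ H.Reachable a x ∧ H.Reachable a y ∧ α x < α w ∧ α w < α y := by
  classical
  obtain ⟨p⟩ := hab
  obtain ⟨d, hd, h1, h2⟩ := p.exists_boundary_dart {x | α x < α w} haw hwb.not_gt
  have hx : H.Reachable a d.fst := ⟨p.takeUntil _ (p.dart_fst_mem_support_of_mem_darts hd)⟩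
  have hy : H.Reachable a d.snd := hx.trans d.adj.reachable
  refine ⟨d.fst, d.snd, d.adj, hx, hy, h1, lt_of_le_of_ne (not_lt.1 h2) fun h => hw ?_⟩
  rwa [α.injective h]

/-- Two vertex classes joined by the single edge `uv`, the first of which contains the first vertex
of `α` and the second one the last vertex: if they interlace, then listing the first class
before the second one strictly decreases the net cost. -/
theorem exists_netCost_lt_of_interlaced {V : Type*} [Fintype V] {G : SimpleGraph V}
    {α : V ≃ Fin (Nat.card V)} {S : Set V} {u v a b p q : V} (hu : u ∈ S) (hv : v ∉ S)
    (hedge : ∀ x y, G.Adj x y → s(x, y) ≠ s(u, v) → (x ∈ S ↔ y ∈ S))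
    (hS : ∀ a ∈ S, ∀ b ∈ S, ∀ w ∉ S, α a < α w → α w < α b →
      ∃ x ∈ S, ∃ y ∈ S, G.Adj x y ∧ α x < α w ∧ α w < α y)
    (hSc : ∀ a ∉ S, ∀ b ∉ S, ∀ w ∈ S, α a < α w → α w < α b →
      ∃ x ∉ S, ∃ y ∉ S, G.Adj x y ∧ α x < α w ∧ α w < α y)
    (hp : p ∈ S) (hpmin : ∀ x, α p ≤ α x) (hq : q ∉ S) (hqmax : ∀ x, α x ≤ α q)
    (ha : a ∈ S) (hb : b ∉ S) (hba : α b < α a) :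
    ∃ β : V ≃ Fin (Nat.card V), netCost G (arr β) < netCost G (arr α) := by
  classical
  have hinj : Function.Injective
      fun x => (if x ∈ S then 0 else Nat.card V) + (α x : ℕ) := by
    intro x y hxy
    have := (α x).2
    have := (α y).2
    apply α.injective
    ext
    grind
  obtain ⟨β, hβ⟩ := exists_arrangement_lt_iff hinj
  have hβ' : ∀ x y, β x < β y ↔ (x ∈ S ∧ y ∉ S) ∨ ((x ∈ S ↔ y ∈ S) ∧ α x < α y) := by
    intro x y
    rw [hβ, Fin.lt_def]
    have := (α x).2
    have := (α y).2
    grind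
  clear hβ hinj
  refine ⟨β, ?_⟩
  rw [netCost_arr_eq_sum, netCost_arr_eq_sum]
  set Z : Set V := {w | (w ∈ S ∧ ∃ b ∉ S, α b < α w) ∨ (w ∉ S ∧ ∃ a ∈ S, α w < α a)} with hZ
  have hne : ∀ x y, x ∈ S → y ∉ S → α x ≠ α y := fun x y hx hy h => hy (α.injective h ▸ hx)
  have hsub : ∀ w, (edgesOver G β w).erase s(u, v) ⊆ (edgesOver G α w).erase s(u, v) := by
    intro w e
    induction e with | _ x y
    simp only [Finset.mem_erase, mem_edgesOver, hβ']
    rintro ⟨h1, h2, h3⟩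
    have := hedge x y h2 h1
    grind
  have hZsub : ∀ w ∈ Z, (edgesOver G β w).erase s(u, v) ⊂ (edgesOver G α w).erase s(u, v) := by
    intro w hw
    refine Finset.ssubset_iff_subset_ne.2 ⟨hsub w, fun heq => ?_⟩
    have key : ∃ x y, (x ∈ S ↔ y ∈ S) ∧ ¬(x ∈ S ↔ w ∈ S) ∧ G.Adj x y ∧
        α x < α w ∧ α w < α y := by
      rcases hw with ⟨hwS, c, hc, hcw⟩ | ⟨hwS, c, hc, hcw⟩
      · obtain ⟨x, hx, y, hy, h⟩ := hSc c hc q hq w hwS hcw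
          ((hqmax w).lt_of_ne (hne w q hwS hq))
        exact ⟨x, y, by tauto, by tauto, h⟩
      · obtain ⟨x, hx, y, hy, h⟩ := hS p hp c hc w hwS
          ((hpmin w).lt_of_ne (hne p w hp hwS)) hcw
        exact ⟨x, y, by tauto, by tauto, h⟩
    obtain ⟨x, y, hxy, hxw, hadj, h1, h2⟩ := key
    have hmem : s(x, y) ∈ (edgesOver G α w).erase s(u, v) := by
      refine Finset.mem_erase.2 ⟨?_, mem_edgesOver.2 ⟨hadj, .inl ⟨h1, h2⟩⟩⟩
      rw [Ne, Sym2.eq_iff]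
      rintro (⟨rfl, rfl⟩ | ⟨rfl, rfl⟩) <;> tauto
    rw [← heq, Finset.mem_erase, mem_edgesOver] at hmem
    simp only [hβ'] at hmem
    grind
  have hbr : ∀ w ∉ Z, s(u, v) ∈ edgesOver G β w → s(u, v) ∈ edgesOver G α w := by
    intro w hw
    simp only [mem_edgesOver, hβ']
    simp only [hZ, Set.mem_ofPred_eq, not_or, not_and, not_exists, not_lt] at hw
    rintro ⟨h1, h2⟩
    refine ⟨h1, ?_⟩
    have h3 := hw.1
    have h4 := hw.2
    by_cases hwS : w ∈ S
    · have := hne w v hwS hv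
      have := h3 hwS v hv
      left
      constructor
      · grind
      · exact lt_of_le_of_ne this ‹_›
    · have := hne u w hu hwS
      have := h4 hwS u hu
      left
      constructor
      · exact lt_of_le_of_ne this ‹_›
      · grind
  have hcard : ∀ (γ : V ≃ Fin (Nat.card V)) w, (edgesOver G γ w).card =
      ((edgesOver G γ w).erase s(u, v)).card + if s(u, v) ∈ edgesOver G γ w then 1 else 0 := by
    intro γ w
    split_ifs with h
    · rw [Finset.card_erase_add_one h]
    · rw [Finset.erase_eq_of_notMem h, add_zero]
  have hstrict : ∃ w ∈ Z, s(u, v) ∈ edgesOver G β w → s(u, v) ∈ edgesOver G α w := by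
    by_cases huZ : u ∈ Z
    · refine ⟨u, huZ, fun h => ?_⟩
      simp [mem_edgesOver, hβ', hu, hv] at h
    by_cases hvZ : v ∈ Z
    · refine ⟨v, hvZ, fun h => ?_⟩
      simp [mem_edgesOver, hβ', hu, hv] at h
    refine ⟨a, .inl ⟨ha, b, hb, hba⟩, fun h => ?_⟩
    have hub : α u ≤ α b := not_lt.1 fun h => huZ (.inl ⟨hu, b, hb, h⟩)
    have hav : α a ≤ α v := not_lt.1 fun h => hvZ (.inr ⟨hv, a, ha, h⟩)
    exact mem_edgesOver.2 ⟨(mem_edgesOver.1 h).1,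
      .inl ⟨hub.trans_lt hba, hav.lt_of_ne (hne a v ha hv)⟩⟩
  obtain ⟨w₀, hw₀, hw₀'⟩ := hstrict
  refine Finset.sum_lt_sum (fun w _ => ?_) ⟨w₀, Finset.mem_univ _, ?_⟩
  · rw [hcard α, hcard β]
    by_cases hw : w ∈ Z
    · have := Finset.card_lt_card (hZsub w hw)
      split_ifs <;> omega
    · have := Finset.card_le_card (hsub w)
      have := hbr w hw
      split_ifs <;> first | omega | tauto
  · rw [hcard α, hcard β]
    have := Finset.card_lt_card (hZsub w₀ hw₀)
    split_ifs <;> first | omega | tauto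

theorem card_le_netCost_of_forall_over {V : Type*} [Fintype V] {G : SimpleGraph V}
    {α : V ≃ Fin (Nat.card V)} {T : Set V}
    (hT : ∀ w ∈ T, ∃ x y, G.Adj x y ∧ α x < α w ∧ α w < α y) :
    Nat.card T ≤ netCost G (arr α) := by
  classical
  rw [netCost_arr_eq_sum, Nat.card_eq_fintype_card, ← Set.toFinset_card, Finset.card_eq_sum_ones]
  calc ∑ w ∈ T.toFinset, 1 ≤ ∑ w ∈ T.toFinset, (edgesOver G α w).card := by
        refine Finset.sum_le_sum fun w hw => Finset.card_pos.2 ?_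
        obtain ⟨x, y, h, hxy⟩ := hT w (Set.mem_toFinset.1 hw)
        exact ⟨s(x, y), mem_edgesOver.2 ⟨h, .inl hxy⟩⟩
    _ ≤ ∑ w, (edgesOver G α w).card :=
        Finset.sum_le_sum_of_subset (Finset.subset_univ _)

theorem reachable_deleteEdges_or {V : Type*} {G : SimpleGraph V} (hconn : G.Connected) (u v x : V) :
    (G.deleteEdges {s(u, v)}).Reachable u x ∨ (G.deleteEdges {s(u, v)}).Reachable v x := by
  obtain ⟨p⟩ := hconn u x
  by_contra hx
  obtain ⟨d, -, h1, h2⟩ := p.exists_boundary_dart {x | (G.deleteEdges {s(u, v)}).Reachable u x ∨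
    (G.deleteEdges {s(u, v)}).Reachable v x} (.inl .rfl) hx
  apply h2
  by_cases hd : s(d.fst, d.snd) = s(u, v)
  · rcases Sym2.eq_iff.1 hd with ⟨-, h⟩ | ⟨-, h⟩
    · exact .inr (h ▸ .rfl)
    · exact .inl (h ▸ .rfl)
  · have hadj : (G.deleteEdges {s(u, v)}).Adj d.fst d.snd :=
      SimpleGraph.deleteEdges_adj.2 ⟨d.adj, hd⟩
    exact h1.imp (·.trans hadj.reachable) (·.trans hadj.reachable)

theorem comparable_of_ksep_bridge {V : Type*} [Finite V] (G : SimpleGraph V)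
    (hconn : G.Connected) (k : ℕ) (hk : 1 ≤ k) (hka : olaPlus G ≤ k)
    (α : V ≃ Fin (Nat.card V)) (hopt : netCost G (arr α) = olaPlus G)
    (u v : V) (hbridge : IsKSepBridge G k u v) :
    (∀ a ∈ ((G.deleteEdges {s(u, v)}).connectedComponentMk u).supp,
      ∀ b ∈ ((G.deleteEdges {s(u, v)}).connectedComponentMk v).supp, α a < α b) ∨
    (∀ a ∈ ((G.deleteEdges {s(u, v)}).connectedComponentMk u).supp,
      ∀ b ∈ ((G.deleteEdges {s(u, v)}).connectedComponentMk v).supp, α b < α a) := by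
  classical
  have := Fintype.ofFinite V
  obtain ⟨hbr, hcu, hcv⟩ := hbridge
  set H := G.deleteEdges {s(u, v)} with hH
  have hHG : ∀ x y, H.Adj x y → G.Adj x y := fun x y h => (SimpleGraph.deleteEdges_adj.1 h).1
  have huv : ¬ H.Reachable u v := by
    rw [SimpleGraph.isBridge_iff] at hbr
    exact hbr
  have hsupp : ∀ c x, x ∈ (H.connectedComponentMk c).supp ↔ H.Reachable c x := fun c x => by
    rw [SimpleGraph.ConnectedComponent.mem_supp_iff, SimpleGraph.ConnectedComponent.eq]
    exact SimpleGraph.reachable_comm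
  have hor : ∀ x, H.Reachable u x ∨ H.Reachable v x := reachable_deleteEdges_or hconn u v
  have hnot : ∀ x, H.Reachable u x → ¬ H.Reachable v x := fun x h h' => huv (h.trans h'.symm)
  have hiff : ∀ x, H.Reachable v x ↔ ¬ H.Reachable u x := fun x =>
    ⟨fun h h' => hnot x h' h, (hor x).resolve_left⟩
  have hedge : ∀ c x y, G.Adj x y → s(x, y) ≠ s(u, v) → (H.Reachable c x ↔ H.Reachable c y) := by
    intro c x y h hne
    have hadj : H.Adj x y := SimpleGraph.deleteEdges_adj.2 ⟨h, hne⟩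
    exact ⟨(·.trans hadj.reachable), (·.trans hadj.symm.reachable)⟩
  have hover : ∀ c a b w, H.Reachable c a → H.Reachable c b → ¬ H.Reachable c w →
      α a < α w → α w < α b → ∃ x, H.Reachable c x ∧ ∃ y, H.Reachable c y ∧
        G.Adj x y ∧ α x < α w ∧ α w < α y := by
    intro c a b w ha hb hw haw hwb
    obtain ⟨x, y, h, hx, hy, hxy⟩ := exists_adj_over_of_reachable (ha.symm.trans hb)
      (fun h => hw (ha.trans h)) haw hwb
    exact ⟨x, ha.trans hx, y, ha.trans hy, hHG x y h, hxy⟩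
  have hmin : ∀ β : V ≃ Fin (Nat.card V), ¬ netCost G (arr β) < netCost G (arr α) := fun β => by
    rw [hopt, olaPlus]
    exact not_lt.2 (Nat.sInf_le (Set.mem_ofPred_eq ▸ ⟨β, rfl⟩))
  have : Nonempty V := ⟨u⟩
  obtain ⟨p, hp⟩ := Finite.exists_min α
  obtain ⟨q, hq⟩ := Finite.exists_max α
  have hends : ∀ c d, k < Nat.card (H.connectedComponentMk d).supp →
      (∀ x, H.Reachable d x → ¬ H.Reachable c x) → ¬ (H.Reachable c p ∧ H.Reachable c q) := by
    rintro c d hd hdc ⟨hcp, hcq⟩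
    refine (hd.trans_le (card_le_netCost_of_forall_over (G := G) (α := α) fun w hw => ?_)).not_ge
      (hopt.trans_le hka)
    have hwc := hdc w ((hsupp d w).1 hw)
    obtain ⟨x, -, y, -, h⟩ := hover c p q w hcp hcq hwc
      ((hp w).lt_of_ne fun h => hwc (α.injective h ▸ hcp))
      ((hq w).lt_of_ne fun h => hwc (α.injective h ▸ hcq))
    exact ⟨x, y, h⟩
  have hu_ends := hends u v hcv fun x h h' => hnot x h' h
  have hv_ends := hends v u hcu hnot
  simp only [hsupp]
  by_cases hup : H.Reachable u p
  · left
    intro a ha b hb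
    by_contra hab
    obtain ⟨β, hβ⟩ := exists_netCost_lt_of_interlaced (G := G) (α := α)
      (S := {x | H.Reachable u x}) (u := u) (v := v) (p := p) (q := q) (a := a) (b := b)
      (SimpleGraph.Reachable.refl u) huv (hedge u)
      (fun a ha b hb w hw => hover u a b w ha hb hw)
      (fun a ha b hb w hw h1 h2 => by
        obtain ⟨x, hx, y, hy, h⟩ :=
          hover v a b w ((hiff a).2 ha) ((hiff b).2 hb) (hnot w hw) h1 h2
        exact ⟨x, (hiff x).1 hx, y, (hiff y).1 hy, h⟩)
      hup hp (fun h => hu_ends ⟨hup, h⟩) hq ha ((hiff b).1 hb)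
      ((not_lt.1 hab).lt_of_ne fun h => hnot a ha (α.injective h ▸ hb))
    exact hmin β hβ
  · right
    intro a ha b hb
    by_contra hab
    have hvp := (hiff p).2 hup
    obtain ⟨β, hβ⟩ := exists_netCost_lt_of_interlaced (G := G) (α := α)
      (S := {x | H.Reachable v x}) (u := v) (v := u) (p := p) (q := q) (a := b) (b := a)
      (SimpleGraph.Reachable.refl v) (fun h => huv h.symm)
      (fun x y h hne => hedge v x y h (by rwa [Sym2.eq_swap (a := u)]))
      (fun a ha b hb w hw => hover v a b w ha hb hw)
      (fun a ha b hb w hw h1 h2 => by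
        obtain ⟨x, hx, y, hy, h⟩ := hover u a b w ((hor a).resolve_right ha)
          ((hor b).resolve_right hb) (fun h => hnot w h hw) h1 h2
        exact ⟨x, hnot x hx, y, hnot y hy, h⟩)
      hvp hp (fun h => hv_ends ⟨hvp, h⟩) hq hb (hnot a ha)
      ((not_lt.1 hab).lt_of_ne fun h => hnot a ha (α.injective h ▸ hb))
    exact hmin β hβ
end

section
/- Let G be a connected graph and v a vertex of degree 2 with non-adjacent neighbors u₁,u₂, such that both edges vu₁ and vu₂ are k-separating bridges of G for k = ola⁺(G). Let G' be the graph obtained by deleting v and adding the edge u₁u₂. Then ola⁺(G) = ola⁺(G'). -/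
open scoped BigOperators

/-- The triples `(x, w, y)` such that `xy` is an edge of `G` and `w` lies strictly between `x` and
`y` in the labelling `f`. -/
def coverTriples {V : Type*} (G : SimpleGraph V) (f : V → ℕ) : Set (V × V × V) :=
  {t | G.Adj t.1 t.2.2 ∧ f t.1 < f t.2.1 ∧ f t.2.1 < f t.2.2}

/-- The covering triples avoiding `v`, where `u₁u₂` counts as an additional edge. -/
def suppressTriples {V : Type*} (G : SimpleGraph V) (v u₁ u₂ : V) (f : V → ℕ) :
    Set (V × V × V) :=
  {t | t.1 ≠ v ∧ t.2.1 ≠ v ∧ t.2.2 ≠ v ∧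
    (G.Adj t.1 t.2.2 ∨ (t.1 = u₁ ∧ t.2.2 = u₂) ∨ (t.1 = u₂ ∧ t.2.2 = u₁)) ∧
    f t.1 < f t.2.1 ∧ f t.2.1 < f t.2.2}

/-- `x` is reachable from `u` in `G` by a walk avoiding `v`. -/
def ReachAvoiding {V : Type*} (G : SimpleGraph V) (v u x : V) : Prop :=
  Relation.ReflTransGen (fun a b => G.Adj a b ∧ a ≠ v ∧ b ≠ v) u x

lemma suppressTriples_comm {V : Type*} (G : SimpleGraph V) (v u₁ u₂ : V) (f : V → ℕ) :
    suppressTriples G v u₁ u₂ f = suppressTriples G v u₂ u₁ f := by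
  ext t
  simp only [suppressTriples, Set.mem_ofPred_eq]
  tauto

lemma Set.ncard_le_ncard_of_forall_exists {α β : Type*} [Finite β] {s : Set α} {t : Set β}
    (r : α → β → Prop) (h : ∀ a ∈ s, ∃ b ∈ t, r a b)
    (hr : ∀ a ∈ s, ∀ a' ∈ s, ∀ b, r a b → r a' b → a = a') : s.ncard ≤ t.ncard := by
  classical
  rcases s.eq_empty_or_nonempty with rfl | ⟨a₀, ha₀⟩
  · simp
  have : Nonempty β := ⟨(h a₀ ha₀).choose⟩
  choose! g hg hrg using h
  refine Set.ncard_le_ncard_of_injOn g hg ?_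
  intro a ha a' ha' e
  exact hr a ha a' ha' (g a) (hrg a ha) (e ▸ hrg a' ha')

lemma netCost_arr {V : Type*} [Finite V] (G : SimpleGraph V) (α : V ≃ Fin (Nat.card V)) :
    netCost G (arr α) = (coverTriples G (arr α)).ncard := by
  classical
  have := Fintype.ofFinite V
  have hinj : Function.Injective (arr α) := by
    intro x y h
    simp only [arr] at h
    exact α.injective (Fin.ext (by omega))
  have hT : (coverTriples G (arr α)).Finite := Set.toFinite _
  rw [netCost, finsum_mem_eq_finite_toFinset_sum _ (Set.toFinite _),
    Set.ncard_eq_toFinset_card _ hT,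
    Finset.card_eq_sum_card_fiberwise (f := fun t : V × V × V => s(t.1, t.2.2))
      (t := (Set.toFinite G.edgeSet).toFinset)
      (by intro t ht; simp only [Set.Finite.coe_toFinset] at ht ⊢; exact ht.1)]
  refine Finset.sum_congr rfl ?_
  intro e
  induction e using Sym2.ind with
  | _ a b =>
  intro he
  have hab : G.Adj a b := by simpa using he
  wlog hlt : arr α a < arr α b generalizing a b
  · have hne : arr α a ≠ arr α b := fun h => hab.ne (hinj h)
    rw [Sym2.eq_swap]
    exact this b a (by simpa using hab.symm) hab.symm (by omega)
  have hl : edgeLen (arr α) s(a, b) - 1 = (Finset.Ioo (α a) (α b)).card := by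
    rw [Fin.card_Ioo]
    simp only [edgeLen, Sym2.lift_mk, arr] at hlt ⊢
    omega
  rw [hl]
  refine Finset.card_bij (fun i _ => (a, α.symm i, b)) ?_ ?_ ?_
  · intro i hi
    rw [Finset.mem_Ioo, Fin.lt_def, Fin.lt_def] at hi
    simp only [coverTriples, arr, Finset.mem_filter, Set.Finite.mem_toFinset, Set.mem_ofPred_eq,
      Equiv.apply_symm_apply, and_true]
    exact ⟨hab, by omega, by omega⟩
  · intro i _ j _ h
    simpa using h
  · rintro ⟨x, w, y⟩ h
    simp only [coverTriples, Finset.mem_filter, Set.Finite.mem_toFinset, Set.mem_ofPred_eq,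
      Sym2.eq_iff] at h
    obtain ⟨⟨-, h1, h2⟩, ⟨rfl, rfl⟩ | ⟨rfl, rfl⟩⟩ := h
    · refine ⟨α w, ?_, by simp⟩
      simp only [arr] at h1 h2
      rw [Finset.mem_Ioo, Fin.lt_def, Fin.lt_def]
      omega
    · omega

lemma exists_olaPlus_eq {V : Type*} [Finite V] (G : SimpleGraph V) :
    ∃ f : V → ℕ, Function.Injective f ∧ olaPlus G = (coverTriples G f).ncard := by
  have hne : {c : ℕ | ∃ α : V ≃ Fin (Nat.card V), netCost G (arr α) = c}.Nonempty :=
    ⟨_, Finite.equivFin V, rfl⟩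
  obtain ⟨α, hα⟩ := Nat.sInf_mem hne
  refine ⟨arr α, ?_, ?_⟩
  · intro x y h
    simp only [arr] at h
    exact α.injective (Fin.ext (by omega))
  · rw [← netCost_arr, hα, olaPlus]

lemma olaPlus_le {V : Type*} [Finite V] (G : SimpleGraph V) {f : V → ℕ}
    (hf : Function.Injective f) : olaPlus G ≤ (coverTriples G f).ncard := by
  classical
  have := Fintype.ofFinite V
  let L : LinearOrder V := LinearOrder.lift' f hf
  let e := Fintype.orderIsoFinOfCardEq V (Nat.card_eq_fintype_card (α := V)).symm
  refine Nat.sInf_le ⟨e.symm.toEquiv, ?_⟩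
  have key : ∀ x y : V, arr e.symm.toEquiv x < arr e.symm.toEquiv y ↔ f x < f y := by
    intro x y
    have h : e.symm x < e.symm y ↔ x < y := e.symm.lt_iff_lt
    rw [Fin.lt_def] at h
    change (e.symm x : ℕ) + 1 < (e.symm y : ℕ) + 1 ↔ f x < f y
    rw [Nat.add_lt_add_iff_right, h]
    rfl
  rw [netCost_arr]
  congr 1
  ext t
  simp only [coverTriples, Set.mem_ofPred_eq, key]

lemma ncard_coverTriples_suppress {V : Type*} [Finite V] (G : SimpleGraph V) {v u₁ u₂ : V}
    (hu12 : u₁ ≠ u₂) (h₁ : u₁ ∈ ({v}ᶜ : Set V)) (h₂ : u₂ ∈ ({v}ᶜ : Set V)) (f : V → ℕ) :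
    (coverTriples ((G.induce ({v}ᶜ : Set V)) ⊔
        SimpleGraph.fromEdgeSet {s((⟨u₁, h₁⟩ : ({v}ᶜ : Set V)), (⟨u₂, h₂⟩ : ({v}ᶜ : Set V)))})
      (fun x => f x)).ncard = (suppressTriples G v u₁ u₂ f).ncard := by
  refine Set.ncard_congr (fun t _ => ((t.1 : V), (t.2.1 : V), (t.2.2 : V))) ?_ ?_ ?_
  · rintro ⟨⟨x, hx⟩, ⟨w, hw⟩, ⟨y, hy⟩⟩ ⟨hadj, h⟩
    refine ⟨hx, hw, hy, ?_, h⟩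
    simpa [hu12] using hadj.imp_right And.left
  · rintro ⟨x, w, y⟩ ⟨x', w', y'⟩ _ _ h
    simpa [Subtype.ext_iff] using h
  · rintro ⟨x, w, y⟩ ⟨hx, hw, hy, hadj, h⟩
    refine ⟨(⟨x, hx⟩, ⟨w, hw⟩, ⟨y, hy⟩), ⟨?_, h⟩, rfl⟩
    simp only [SimpleGraph.sup_adj, SimpleGraph.comap_adj, SimpleGraph.fromEdgeSet_adj,
      Set.mem_singleton_iff, Sym2.eq_iff, ne_eq, Function.Embedding.subtype_apply]
    grind

lemma ncard_suppressTriples_le {V : Type*} [Finite V] (G : SimpleGraph V) {v u₁ u₂ : V}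
    (hu12 : u₁ ≠ u₂) (hadj₁ : G.Adj v u₁) (hadj₂ : G.Adj v u₂) (hnadj : ¬ G.Adj u₁ u₂)
    {f : V → ℕ} (hf : Function.Injective f) :
    (suppressTriples G v u₁ u₂ f).ncard ≤ (coverTriples G f).ncard := by
  have hnadj' : ¬ G.Adj u₂ u₁ := fun h => hnadj h.symm
  refine Set.ncard_le_ncard_of_forall_exists
    (fun t s => s.2.1 = t.2.1 ∧ ((G.Adj t.1 t.2.2 ∧ s = t) ∨
      (¬ G.Adj t.1 t.2.2 ∧ ((s.1 = t.1 ∧ s.2.2 = v) ∨ (s.1 = v ∧ s.2.2 = t.2.2))))) ?_ ?_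
  · rintro ⟨x, w, y⟩ ⟨hx, hw, hy, hadj, hxw, hwy⟩
    simp only at hx hw hy hadj hxw hwy
    by_cases h : G.Adj x y
    · exact ⟨(x, w, y), ⟨h, hxw, hwy⟩, rfl, Or.inl ⟨h, rfl⟩⟩
    · have hxv : G.Adj x v ∧ G.Adj v y := by
        rcases hadj with hadj | ⟨rfl, rfl⟩ | ⟨rfl, rfl⟩
        · exact absurd hadj h
        · exact ⟨hadj₁.symm, hadj₂⟩
        · exact ⟨hadj₂.symm, hadj₁⟩
      rcases lt_or_gt_of_ne (hf.ne hw) with hlt | hlt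
      · exact ⟨(x, w, v), ⟨hxv.1, hxw, hlt⟩, rfl, Or.inr ⟨h, Or.inl ⟨rfl, rfl⟩⟩⟩
      · exact ⟨(v, w, y), ⟨hxv.2, hlt, hwy⟩, rfl, Or.inr ⟨h, Or.inr ⟨rfl, rfl⟩⟩⟩
  · rintro ⟨x, w, y⟩ ⟨hx, hw, hy, hadj, -⟩ ⟨x', w', y'⟩ ⟨hx', hw', hy', hadj', -⟩ ⟨p, q, r⟩
    simp only [Prod.mk.injEq]
    simp only at hx hw hy hadj hx' hw' hy' hadj'
    grind

lemma ReachAvoiding.exists_adj_cover {V : Type*} {G : SimpleGraph V} {v u a b w : V} {f : V → ℕ}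
    (hf : Set.InjOn f {v}ᶜ) (hwv : w ≠ v) (hw : ¬ ReachAvoiding G v u w)
    (ha : ReachAvoiding G v u a) (hb : ReachAvoiding G v u b) (haw : f a < f w)
    (hwb : f w < f b) :
    ∃ x y, ReachAvoiding G v u x ∧ ReachAvoiding G v u y ∧ x ≠ v ∧ y ≠ v ∧ G.Adj x y ∧
      f x < f w ∧ f w < f y := by
  by_contra! hcon
  have key : ∀ c d, ReachAvoiding G v u c → G.Adj c d → c ≠ v → d ≠ v →
      (f c < f w ↔ f d < f w) := by
    intro c d hc hcd hcv hdv
    have hd : ReachAvoiding G v u d := hc.tail ⟨hcd, hcv, hdv⟩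
    have hcw : f c ≠ f w := fun h => hw (hf hcv hwv h ▸ hc)
    have hdw : f d ≠ f w := fun h => hw (hf hdv hwv h ▸ hd)
    have h1 := hcon c d hc hd hcv hdv hcd
    have h2 := hcon d c hd hc hdv hcv hcd.symm
    omega
  have hroot : ∀ c, ReachAvoiding G v u c → (f u < f w ↔ f c < f w) := by
    intro c hc
    induction hc with
    | refl => rfl
    | tail hc hcd ih => exact ih.trans (key _ _ hc hcd.1 hcd.2.1 hcd.2.2)
  have h1 := hroot a ha
  have h2 := hroot b hb
  omega

lemma ReachAvoiding.ne {V : Type*} {G : SimpleGraph V} {v u x : V} (hu : u ≠ v)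
    (h : ReachAvoiding G v u x) : x ≠ v := by
  induction h with
  | refl => exact hu
  | tail _ h _ => exact h.2.2

lemma ncard_le_ncard_suppressTriples {V : Type*} [Finite V] {G : SimpleGraph V} {v u₁ u₂ m M : V}
    {f : V → ℕ} {B : Set V} (hf : Set.InjOn f {v}ᶜ) (hu₁ : u₁ ≠ v) (hB : v ∉ B)
    (hdisj : ∀ x ∈ B, ¬ ReachAvoiding G v u₁ x)
    (hm : ReachAvoiding G v u₁ m) (hM : ReachAvoiding G v u₁ M)
    (hmin : ∀ x, x ≠ v → f m ≤ f x) (hmax : ∀ x, x ≠ v → f x ≤ f M) :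
    B.ncard ≤ (suppressTriples G v u₁ u₂ f).ncard := by
  refine Set.ncard_le_ncard_of_forall_exists (fun b t => t.2.1 = b) ?_ ?_
  · intro b hb
    have hbv : b ≠ v := fun h => hB (h ▸ hb)
    have hmb : f m ≠ f b := fun h => hdisj b hb (hf (hm.ne hu₁) hbv h ▸ hm)
    have hMb : f b ≠ f M := fun h => hdisj b hb (hf hbv (hM.ne hu₁) h ▸ hM)
    obtain ⟨x, y, -, -, hx, hy, hxy, h1, h2⟩ := ReachAvoiding.exists_adj_cover hf hbv
      (hdisj b hb) hm hM (lt_of_le_of_ne (hmin b hbv) hmb) (lt_of_le_of_ne (hmax b hbv) hMb)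
    exact ⟨(x, b, y), ⟨hx, hbv, hy, Or.inl hxy, h1, h2⟩, rfl⟩
  · rintro a - a' - t rfl rfl
    rfl

lemma exists_injective_ncard_coverTriples_le {V : Type*} [Finite V] {G : SimpleGraph V}
    {v u₁ u₂ m M : V} {f : V → ℕ} (hnbr : ∀ x, G.Adj v x ↔ x = u₁ ∨ x = u₂)
    (hf : Set.InjOn f {v}ᶜ)
    (hdisj : ∀ x, ReachAvoiding G v u₁ x → ¬ ReachAvoiding G v u₂ x)
    (hcov : ∀ x, x ≠ v → ReachAvoiding G v u₁ x ∨ ReachAvoiding G v u₂ x)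
    (hm : ReachAvoiding G v u₁ m) (hM : ReachAvoiding G v u₂ M)
    (hmin : ∀ x, x ≠ v → f m ≤ f x) (hmax : ∀ x, x ≠ v → f x ≤ f M) :
    ∃ g : V → ℕ, Function.Injective g ∧
      (coverTriples G g).ncard ≤ (suppressTriples G v u₁ u₂ f).ncard := by
  classical
  have hu₁ : u₁ ≠ v := ((hnbr u₁).2 (Or.inl rfl)).ne'
  have hu₂ : u₂ ≠ v := ((hnbr u₂).2 (Or.inr rfl)).ne'
  have hr₁ : ReachAvoiding G v u₁ u₁ := Relation.ReflTransGen.refl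
  have hr₂ : ReachAvoiding G v u₂ u₂ := Relation.ReflTransGen.refl
  have hstep : ∀ u x y, ReachAvoiding G v u x → G.Adj x y → x ≠ v → y ≠ v →
      ReachAvoiding G v u y := fun u x y h hxy hx hy => h.tail ⟨hxy, hx, hy⟩
  set A : Set V := {x | ReachAvoiding G v u₁ x} with hA
  set B : Set V := {x | ReachAvoiding G v u₂ x} with hB
  have hAv : ∀ x ∈ A, x ≠ v := fun x hx => ReachAvoiding.ne hu₁ hx
  have hBv : ∀ x ∈ B, x ≠ v := fun x hx => ReachAvoiding.ne hu₂ hx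
  have hcovA : ∀ w ∈ A, f u₂ < f w → ∃ x ∈ B, ∃ y ∈ B, G.Adj x y ∧ f x < f w ∧ f w < f y := by
    intro w hw hlt
    have hne : f w ≠ f M := fun h => hdisj w hw (hf (hAv w hw) (hBv M hM) h ▸ hM)
    obtain ⟨x, y, hx, hy, -, -, hxy, h1, h2⟩ := ReachAvoiding.exists_adj_cover hf (hAv w hw)
      (hdisj w hw) hr₂ hM hlt (lt_of_le_of_ne (hmax w (hAv w hw)) hne)
    exact ⟨x, hx, y, hy, hxy, h1, h2⟩
  have hcovB : ∀ w ∈ B, f w < f u₁ → ∃ x ∈ A, ∃ y ∈ A, G.Adj x y ∧ f x < f w ∧ f w < f y := by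
    intro w hw hlt
    have hne : f m ≠ f w := fun h => hdisj m hm (hf (hAv m hm) (hBv w hw) h ▸ hw)
    obtain ⟨x, y, hx, hy, -, -, hxy, h1, h2⟩ := ReachAvoiding.exists_adj_cover hf (hBv w hw)
      (fun h => hdisj w h hw) hm hr₁ (lt_of_le_of_ne (hmin w (hBv w hw)) hne) hlt
    exact ⟨x, hx, y, hy, hxy, h1, h2⟩
  let N := f M + 1
  let g : V → ℕ := fun x => if x = v then N else if x ∈ A then f x else N + 1 + f x
  have hgv : g v = N := by simp [g]
  have hgA : ∀ x ∈ A, g x = f x ∧ f x < N := by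
    intro x hx
    have := hmax x (hAv x hx)
    exact ⟨by simp [g, hAv x hx, hx], by omega⟩
  have hgB : ∀ x ∈ B, g x = N + 1 + f x := by
    intro x hx
    have : x ∉ A := fun h => hdisj x h hx
    simp [g, hBv x hx, this]
  have htri : ∀ x, x = v ∨ x ∈ A ∨ x ∈ B := by
    intro x
    by_cases h : x = v
    · exact Or.inl h
    · exact Or.inr (hcov x h)
  refine ⟨g, ?_, ?_⟩
  · intro x y hxy
    rcases htri x with rfl | hx | hx <;> rcases htri y with hy | hy | hy
    · exact hy.symm
    · have := hgA y hy; omega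
    · have := hgB y hy; omega
    · subst hy; have := hgA x hx; omega
    · have h1 := hgA x hx; have h2 := hgA y hy
      exact hf (hAv x hx) (hAv y hy) (by omega)
    · have h1 := hgA x hx; have h2 := hgB y hy; omega
    · subst hy; have := hgB x hx; omega
    · have h1 := hgB x hx; have h2 := hgA y hy; omega
    · have h1 := hgB x hx; have h2 := hgB y hy
      exact hf (hBv x hx) (hBv y hy) (by omega)
  have hdisj' : ∀ x ∈ A, x ∉ B := hdisj
  refine Set.ncard_le_ncard_of_forall_exists
    (fun t s => s.2.1 = t.2.1 ∧ (
      (s = t ∧ ((t.1 ∈ A ∧ t.2.1 ∈ A ∧ t.2.2 ∈ A) ∨ (t.1 ∈ B ∧ t.2.1 ∈ B ∧ t.2.2 ∈ B))) ∨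
      (t.1 = u₁ ∧ t.2.2 = v ∧ t.2.1 ∈ A ∧ ((s.1 = u₁ ∧ s.2.2 = u₂) ∨ (s.1 ∈ B ∧ s.2.2 ∈ B))) ∨
      (t.1 = v ∧ t.2.2 = u₂ ∧ t.2.1 ∈ B ∧ ((s.1 = u₁ ∧ s.2.2 = u₂) ∨ (s.1 ∈ A ∧ s.2.2 ∈ A)))))
    ?_ ?_
  · rintro ⟨x, w, y⟩ ⟨hadj, hxw, hwy⟩
    simp only at hadj hxw hwy
    rcases htri x with rfl | hx | hx
    · have hwB : w ∈ B := by
        rcases htri w with rfl | hw | hw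
        · omega
        · have := hgA w hw; omega
        · exact hw
      have hwu₁ : f w ≠ f u₁ := fun h => hdisj u₁ hr₁ (hf (hBv w hwB) hu₁ h ▸ hwB)
      have hgw := hgB w hwB
      rcases (hnbr y).1 hadj with rfl | rfl
      · have := hgA _ hr₁; omega
      · have hgy := hgB _ hr₂
        rcases lt_or_gt_of_ne hwu₁ with h | h
        · obtain ⟨p, hp, q, hq, hpq, h1, h2⟩ := hcovB w hwB h
          exact ⟨(p, w, q), ⟨hAv p hp, hBv w hwB, hAv q hq, Or.inl hpq, h1, h2⟩, rfl,
            Or.inr (Or.inr ⟨rfl, rfl, hwB, Or.inr ⟨hp, hq⟩⟩)⟩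
        · exact ⟨(u₁, w, y), ⟨hu₁, hBv w hwB, hu₂, Or.inr (Or.inl ⟨rfl, rfl⟩), h,
            by change f w < f y; omega⟩, rfl, Or.inr (Or.inr ⟨rfl, rfl, hwB, Or.inl ⟨rfl, rfl⟩⟩)⟩
    · have hgx := hgA x hx
      rcases htri y with rfl | hy | hy
      · have hwA : w ∈ A := by
          rcases htri w with rfl | hw | hw
          · omega
          · exact hw
          · have := hgB w hw; omega
        have hwu₂ : f w ≠ f u₂ := fun h => hdisj w hwA (hf (hAv w hwA) hu₂ h ▸ hr₂)
        have hgw := hgA w hwA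
        rcases (hnbr x).1 hadj.symm with rfl | rfl
        · rcases lt_or_gt_of_ne hwu₂ with h | h
          · exact ⟨(x, w, u₂), ⟨hu₁, hAv w hwA, hu₂, Or.inr (Or.inl ⟨rfl, rfl⟩),
              by change f x < f w; omega, h⟩, rfl,
              Or.inr (Or.inl ⟨rfl, rfl, hwA, Or.inl ⟨rfl, rfl⟩⟩)⟩
          · obtain ⟨p, hp, q, hq, hpq, h1, h2⟩ := hcovA w hwA h
            exact ⟨(p, w, q), ⟨hBv p hp, hAv w hwA, hBv q hq, Or.inl hpq, h1, h2⟩, rfl,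
              Or.inr (Or.inl ⟨rfl, rfl, hwA, Or.inr ⟨hp, hq⟩⟩)⟩
        · exact absurd hr₂ (hdisj _ hx)
      · have hgy := hgA y hy
        have hwA : w ∈ A := by
          rcases htri w with rfl | hw | hw
          · omega
          · exact hw
          · have := hgB w hw; omega
        have hgw := hgA w hwA
        exact ⟨(x, w, y), ⟨hAv x hx, hAv w hwA, hAv y hy, Or.inl hadj,
          by change f x < f w; omega, by change f w < f y; omega⟩, rfl,
          Or.inl ⟨rfl, Or.inl ⟨hx, hwA, hy⟩⟩⟩
      · exact absurd hy (hdisj y (hstep u₁ x y hx hadj (hAv x hx) (hBv y hy)))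
    · have hgx := hgB x hx
      rcases htri y with rfl | hy | hy
      · omega
      · have := hgA y hy; omega
      · have hgy := hgB y hy
        have hwB : w ∈ B := by
          rcases htri w with rfl | hw | hw
          · omega
          · have := hgA w hw; omega
          · exact hw
        have hgw := hgB w hwB
        exact ⟨(x, w, y), ⟨hBv x hx, hBv w hwB, hBv y hy, Or.inl hadj,
          by change f x < f w; omega, by change f w < f y; omega⟩, rfl,
          Or.inl ⟨rfl, Or.inr ⟨hx, hwB, hy⟩⟩⟩
  · have hu₁A : u₁ ∈ A := hr₁
    have hu₂B : u₂ ∈ B := hr₂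
    rintro ⟨x, w, y⟩ - ⟨x', w', y'⟩ - ⟨p, q, r⟩
    simp only [Prod.mk.injEq]
    clear_value g
    clear hA hB
    clear_value A B
    grind

lemma not_reachAvoiding_of_isBridge {V : Type*} {G : SimpleGraph V} {v u₁ u₂ : V}
    (hu12 : u₁ ≠ u₂) (hadj₂ : G.Adj v u₂) (hb : G.IsBridge s(v, u₁)) {x : V}
    (h1 : ReachAvoiding G v u₁ x) (h2 : ReachAvoiding G v u₂ x) : False := by
  have key : ∀ u, ReachAvoiding G v u x → (G.deleteEdges {s(v, u₁)}).Reachable u x := by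
    intro u h
    rw [SimpleGraph.reachable_iff_reflTransGen]
    refine Relation.ReflTransGen.mono (fun a b => ?_) _ _ h
    rintro ⟨hab, ha, hb⟩
    simp only [SimpleGraph.deleteEdges_adj, Set.mem_singleton_iff, Sym2.eq_iff]
    grind
  rw [SimpleGraph.isBridge_iff] at hb
  have hv : (G.deleteEdges {s(v, u₁)}).Adj v u₂ := by
    simp only [SimpleGraph.deleteEdges_adj, Set.mem_singleton_iff, Sym2.eq_iff]
    refine ⟨hadj₂, ?_⟩
    rintro (⟨-, h⟩ | ⟨-, h⟩)
    · exact hu12 h.symm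
    · exact hadj₂.ne' h
  exact hb (hv.reachable.trans ((key u₂ h2).trans (key u₁ h1).symm))

lemma IsKSepBridge.lt_ncard {V : Type*} [Finite V] {G : SimpleGraph V} {v u : V} {k : ℕ}
    (h : IsKSepBridge G k v u) : k < {x | ReachAvoiding G v u x}.ncard := by
  refine h.2.2.trans_le ?_
  rw [Nat.card_coe_set_eq]
  refine Set.ncard_le_ncard ?_ (Set.toFinite _)
  intro x hx
  have hb := h.1
  rw [SimpleGraph.isBridge_iff] at hb
  rw [SimpleGraph.ConnectedComponent.mem_supp_iff, SimpleGraph.ConnectedComponent.eq] at hx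
  have hux := (SimpleGraph.reachable_iff_reflTransGen _ _).1 hx.symm
  clear hx
  induction hux with
  | refl => exact Relation.ReflTransGen.refl
  | @tail a b hua hab ih =>
    have hua := (SimpleGraph.reachable_iff_reflTransGen _ _).2 hua
    have hub := hua.trans hab.reachable
    refine Relation.ReflTransGen.tail ih ⟨hab.1, ?_, ?_⟩
    · rintro rfl
      exact hb hua.symm
    · rintro rfl
      exact hb hub.symm

lemma reachAvoiding_or_reachAvoiding {V : Type*} {G : SimpleGraph V} (hconn : G.Connected)
    {v u₁ u₂ : V} (hnbr : ∀ x, G.Adj v x ↔ x = u₁ ∨ x = u₂) (x : V) (hx : x ≠ v) :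
    ReachAvoiding G v u₁ x ∨ ReachAvoiding G v u₂ x := by
  have h := (SimpleGraph.reachable_iff_reflTransGen _ _).1 (hconn.preconnected v x)
  induction h with
  | refl => exact absurd rfl hx
  | @tail a b _ hab ih =>
    by_cases ha : a = v
    · subst ha
      rcases (hnbr b).1 hab with rfl | rfl
      · exact Or.inl Relation.ReflTransGen.refl
      · exact Or.inr Relation.ReflTransGen.refl
    · exact (ih ha).imp (fun h => h.tail ⟨hab, ha, hx⟩) (fun h => h.tail ⟨hab, ha, hx⟩)

/-- suppressing a `ola⁺(G)`-suppressible vertex preserves `ola⁺`. -/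
theorem olaPlus_suppress {V : Type*} [Finite V] (G : SimpleGraph V)
    (hconn : G.Connected) (v u₁ u₂ : V) (hu12 : u₁ ≠ u₂)
    (hnbr : G.neighborSet v = {u₁, u₂}) (hnadj : ¬ G.Adj u₁ u₂)
    (hsep₁ : IsKSepBridge G (olaPlus G) v u₁)
    (hsep₂ : IsKSepBridge G (olaPlus G) v u₂)
    (h₁ : u₁ ∈ ({v}ᶜ : Set V)) (h₂ : u₂ ∈ ({v}ᶜ : Set V)) :
    olaPlus G =
      olaPlus ((G.induce ({v}ᶜ : Set V)) ⊔
        SimpleGraph.fromEdgeSet {s((⟨u₁, h₁⟩ : ({v}ᶜ : Set V)), (⟨u₂, h₂⟩ : ({v}ᶜ : Set V)))}) := by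
  classical
  have hnbr' : ∀ x, G.Adj v x ↔ x = u₁ ∨ x = u₂ := by
    intro x
    rw [← SimpleGraph.mem_neighborSet, hnbr]
    simp
  have hnbr'' : ∀ x, G.Adj v x ↔ x = u₂ ∨ x = u₁ := fun x => (hnbr' x).trans or_comm
  have hadj₁ : G.Adj v u₁ := (hnbr' u₁).2 (Or.inl rfl)
  have hadj₂ : G.Adj v u₂ := (hnbr' u₂).2 (Or.inr rfl)
  have hle : olaPlus ((G.induce ({v}ᶜ : Set V)) ⊔
      SimpleGraph.fromEdgeSet {s((⟨u₁, h₁⟩ : ({v}ᶜ : Set V)), (⟨u₂, h₂⟩ : ({v}ᶜ : Set V)))}) ≤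
      olaPlus G := by
    obtain ⟨f, hf, hfe⟩ := exists_olaPlus_eq G
    rw [hfe]
    refine (olaPlus_le _ (f := fun x : ({v}ᶜ : Set V) => f x)
      (hf.comp Subtype.val_injective)).trans ?_
    rw [ncard_coverTriples_suppress G hu12 h₁ h₂ f]
    exact ncard_suppressTriples_le G hu12 hadj₁ hadj₂ hnadj hf
  refine le_antisymm ?_ hle
  obtain ⟨f', hf', hfe⟩ := exists_olaPlus_eq ((G.induce ({v}ᶜ : Set V)) ⊔
    SimpleGraph.fromEdgeSet {s((⟨u₁, h₁⟩ : ({v}ᶜ : Set V)), (⟨u₂, h₂⟩ : ({v}ᶜ : Set V)))})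
  let f : V → ℕ := fun x => if h : x ∈ ({v}ᶜ : Set V) then f' ⟨x, h⟩ else 0
  have hff' : f' = fun x : ({v}ᶜ : Set V) => f x := by
    funext x
    have hx := x.2
    simp only [f, dif_pos hx]
  have hf : Set.InjOn f {v}ᶜ := by
    intro x hx y hy hxy
    simp only [f, dif_pos hx, dif_pos hy] at hxy
    simpa using hf' hxy
  rw [hff', ncard_coverTriples_suppress G hu12 h₁ h₂ f] at hfe
  rw [hfe] at hle ⊢
  have hdisj : ∀ x, ReachAvoiding G v u₁ x → ¬ ReachAvoiding G v u₂ x :=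
    fun x => not_reachAvoiding_of_isBridge hu12 hadj₂ hsep₁.1
  have hdisj' : ∀ x, ReachAvoiding G v u₂ x → ¬ ReachAvoiding G v u₁ x :=
    fun x h h' => hdisj x h' h
  have hcov := reachAvoiding_or_reachAvoiding hconn hnbr'
  have hcov' := reachAvoiding_or_reachAvoiding hconn hnbr''
  obtain ⟨m, hmv, hmin⟩ := Set.exists_min_image ({v}ᶜ : Set V) f (Set.toFinite _) ⟨u₁, h₁⟩
  obtain ⟨M, hMv, hmax⟩ := Set.exists_max_image ({v}ᶜ : Set V) f (Set.toFinite _) ⟨u₁, h₁⟩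
  have hA := hsep₁.lt_ncard
  have hB := hsep₂.lt_ncard
  rcases hcov m hmv with hm | hm <;> rcases hcov M hMv with hM | hM
  · have := ncard_le_ncard_suppressTriples (u₂ := u₂) hf h₁
      (B := {x | ReachAvoiding G v u₂ x}) (fun h => ReachAvoiding.ne h₂ h rfl) hdisj' hm hM hmin hmax
    omega
  · obtain ⟨g, hg, hgle⟩ :=
      exists_injective_ncard_coverTriples_le hnbr' hf hdisj hcov hm hM hmin hmax
    exact (olaPlus_le G hg).trans hgle
  · obtain ⟨g, hg, hgle⟩ :=
      exists_injective_ncard_coverTriples_le hnbr'' hf hdisj' hcov' hm hM hmin hmax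
    rw [suppressTriples_comm]
    exact (olaPlus_le G hg).trans hgle
  · have := ncard_le_ncard_suppressTriples (u₂ := u₁) hf h₂
      (B := {x | ReachAvoiding G v u₁ x}) (fun h => ReachAvoiding.ne h₁ h rfl) hdisj hm hM hmin hmax
    rw [suppressTriples_comm] at this
    omega
end

section
/- For all n ≥ 2, k ≥ 0, and 0 ≤ j ≤ n−1, the number of linear arrangements α of the path P_n with net cost at most k, α(p₁)=j, and α(p_n)=n is at most 2^{0.119 n + 1.96 k − 0.967095 j + 2}. -/
open scoped BigOperators

namespace PathArrangement

/-- Prepend a gap, written `0`, to a collapsed word, merging it with an adjacent gap. The end of a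
collapsed word is itself an implicit gap. -/
def consGap : List ℕ → List ℕ
  | [] => []
  | 0 :: t => 0 :: t
  | (b + 1) :: t => 0 :: (b + 1) :: t

/-- Replace each maximal run of letters exceeding `i` by a single gap. -/
def collapse (i : ℕ) : List ℕ → List ℕ
  | [] => []
  | a :: l => if a ≤ i then a :: collapse i l else consGap (collapse i l)

/-- All ways of placing the letter `v` in one of the gaps of a collapsed word. -/
def extensions (v : ℕ) : List ℕ → List (List ℕ)
  | [] => [[v], [0, v]]
  | a :: l => (if a = 0 then [v :: l, v :: 0 :: l, 0 :: v :: l, 0 :: v :: 0 :: l] else []) ++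
      (extensions v l).map (a :: ·)

/-- `1` if the word starts with a letter other than a gap, and `0` otherwise. -/
def startsWithLetter : List ℕ → ℕ
  | (_ + 1) :: _ => 1
  | _ => 0

/-- The number of boundaries between letters and gaps. -/
def boundaries (s : List ℕ) : ℕ := 2 * s.count 0 + startsWithLetter s

/-- The length of the walk along `l` that ends in `e`. -/
def walkLength (e : ℕ) : List ℕ → ℕ
  | [] => 0
  | a :: l => ((a : ℤ) - (l.headD e : ℕ)).natAbs + walkLength e l

theorem collapse_succ_of_notMem {i : ℕ} {l : List ℕ} (h : i + 1 ∉ l) :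
    collapse (i + 1) l = collapse i l := by
  induction l with
  | nil => rfl
  | cons a l ih =>
    simp only [List.mem_cons, not_or] at h
    have : a ≤ i + 1 ↔ a ≤ i := by omega
    simp [collapse, ih h.2, this]

theorem collapse_eq_self {i : ℕ} {l : List ℕ} (h : ∀ a ∈ l, a ≤ i) : collapse i l = l := by
  induction l with
  | nil => rfl
  | cons a l ih =>
    simp only [List.mem_cons, forall_eq_or_imp] at h
    simp [collapse, ih h.2, h.1]

theorem collapse_zero {l : List ℕ} (h : ∀ a ∈ l, 1 ≤ a) : collapse 0 l = [] := by
  induction l with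
  | nil => rfl
  | cons a l ih =>
    simp only [List.mem_cons, forall_eq_or_imp] at h
    have : a ≠ 0 := by omega
    simp [collapse, ih h.2, this, consGap]

theorem collapse_succ_mem_extensions {i : ℕ} {l : List ℕ} (hl : l.Nodup) (h : i + 1 ∈ l) :
    collapse (i + 1) l ∈ extensions (i + 1) (collapse i l) := by
  induction l with
  | nil => simp at h
  | cons a l ih =>
    simp only [List.nodup_cons] at hl
    rcases lt_trichotomy a (i + 1) with ha | rfl | ha
    · have h' : i + 1 ∈ l := by
        rcases List.mem_cons.1 h with h | h
        · omega
        · exact h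
      have := ih hl.2 h'
      simp [collapse, show a ≤ i + 1 by omega, show a ≤ i by omega, extensions, this]
    · simp only [collapse, if_pos le_rfl, if_neg (show ¬ i + 1 ≤ i by omega),
        collapse_succ_of_notMem hl.1]
      rcases collapse i l with _ | ⟨_ | b, t⟩ <;> simp [consGap, extensions]
    · have h' : i + 1 ∈ l := by
        rcases List.mem_cons.1 h with h | h
        · omega
        · exact h
      have := ih hl.2 h'
      rw [collapse, if_neg (by omega), collapse, if_neg (by omega)]
      revert this
      generalize collapse (i + 1) l = s
      rcases collapse i l with _ | ⟨_ | b, t⟩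
      · simp only [extensions, List.mem_cons, List.not_mem_nil, or_false, consGap]
        rintro (rfl | rfl) <;> simp
      · simp only [extensions, List.mem_cons, List.not_mem_nil, or_false, consGap, if_true,
          List.mem_append, List.mem_map]
        rintro ((rfl | rfl | rfl | rfl) | ⟨y, hy, rfl⟩) <;> simp_all
      · simp only [extensions, consGap, List.mem_append, List.mem_map]
        rintro (h | ⟨y, hy, rfl⟩)
        · simp at h
        · simp [hy]

theorem sum_count_extensions {v : ℕ} (hv : v ≠ 0) (φ : ℕ → ℝ) (s : List ℕ) :
    ((extensions v s).map fun t => φ (t.count 0)).sum =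
      s.count 0 * φ (s.count 0 - 1) + (2 * s.count 0 + 1) * φ (s.count 0)
        + (s.count 0 + 1) * φ (s.count 0 + 1) := by
  induction s generalizing φ with
  | nil => simp [extensions, hv]
  | cons a l ih =>
    by_cases ha : a = 0
    · subst ha
      have := ih fun p => φ (p + 1)
      simp only [extensions, if_true, List.map_append, List.map_map, List.sum_append,
        Function.comp_def, List.count_cons_self, this]
      simp only [List.map_cons, List.map_nil, List.sum_cons, List.sum_nil,
        List.count_cons_self, List.count_cons_of_ne hv]
      rcases l.count 0 with _ | p
      · simp; ring
      · push_cast [Nat.add_sub_cancel]; ring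
    · have := ih φ
      simp only [extensions, if_neg ha, List.nil_append, List.map_map, Function.comp_def,
        List.count_cons_of_ne ha, this]

theorem startsWithLetter_collapse {i e : ℕ} {l : List ℕ} (he : i < e) (h : ∀ a ∈ l, 1 ≤ a) :
    startsWithLetter (collapse i l) = if l.headD e ≤ i then 1 else 0 := by
  rcases l with _ | ⟨_ | a, l⟩
  · simp [collapse, startsWithLetter, he]
  · simp at h
  · rw [collapse, List.headD_cons]
    split_ifs with ha
    · rfl
    · rcases collapse i l with _ | ⟨_ | b, t⟩ <;> rfl

theorem boundaries_collapse_cons {i e a : ℕ} {l : List ℕ} (he : i < e) (ha : 1 ≤ a)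
    (h : ∀ a ∈ l, 1 ≤ a) :
    boundaries (collapse i (a :: l)) =
      (if (a ≤ i ↔ l.headD e ≤ i) then 0 else 1) + boundaries (collapse i l) := by
  have hs := startsWithLetter_collapse he h
  by_cases hai : a ≤ i
  · obtain ⟨a, rfl⟩ : ∃ b, a = b + 1 := ⟨a - 1, by omega⟩
    rw [collapse, if_pos hai, boundaries, boundaries, hs,
      List.count_cons_of_ne (Nat.succ_ne_zero a), startsWithLetter]
    split_ifs <;> omega
  · simp only [collapse, if_neg hai, boundaries]
    revert hs
    rcases collapse i l with _ | ⟨_ | b, t⟩ <;> simp only [startsWithLetter, consGap] <;>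
      split_ifs <;> simp <;> omega

theorem sum_separating {N a b : ℕ} (ha : 1 ≤ a) (ha' : a ≤ N + 1) (hb : 1 ≤ b) (hb' : b ≤ N + 1) :
    ∑ i ∈ Finset.Ico 1 (N + 1), (if (a ≤ i ↔ b ≤ i) then 0 else 1) =
      ((a : ℤ) - (b : ℕ)).natAbs := by
  have : ∀ i, (if (a ≤ i ↔ b ≤ i) then 0 else 1) = if ¬ (a ≤ i ↔ b ≤ i) then 1 else 0 := by
    intro i; split_ifs <;> simp_all
  simp_rw [this]
  rw [← Finset.card_filter, show (Finset.Ico 1 (N + 1)).filter (fun i => ¬ (a ≤ i ↔ b ≤ i)) =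
    Finset.Ico (min a b) (max a b) by
      ext i; simp only [Finset.mem_filter, Finset.mem_Ico]; omega, Nat.card_Ico]
  omega

theorem sum_boundaries {N : ℕ} {l : List ℕ} (h : ∀ a ∈ l, 1 ≤ a ∧ a ≤ N) :
    ∑ i ∈ Finset.Ico 1 (N + 1), boundaries (collapse i l) = walkLength (N + 1) l := by
  induction l with
  | nil => simp [collapse, boundaries, startsWithLetter, walkLength]
  | cons a l ih =>
    simp only [List.mem_cons, forall_eq_or_imp] at h
    have hd : 1 ≤ l.headD (N + 1) ∧ l.headD (N + 1) ≤ N + 1 := by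
      rcases l with _ | ⟨b, l⟩
      · simp
      · have := h.2 b (by simp)
        simp only [List.headD_cons]; omega
    rw [walkLength, ← ih h.2, ← sum_separating h.1.1 (by omega) hd.1 hd.2,
      ← Finset.sum_add_distrib]
    refine Finset.sum_congr rfl fun i hi => ?_
    rw [Finset.mem_Ico] at hi
    exact boundaries_collapse_cons hi.2 h.1.1 fun a ha => (h.2 a ha).1

theorem walkLength_ofFn {N : ℕ} (f : Fin (N + 1) → ℕ) :
    walkLength (f (Fin.last N)) (List.ofFn fun k : Fin N => f k.castSucc) =
      ∑ k : Fin N, ((f k.castSucc : ℤ) - (f k.succ : ℕ)).natAbs := by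
  induction N with
  | zero => simp [walkLength]
  | succ N ih =>
    have := ih fun k => f k.succ
    rw [List.ofFn_succ, walkLength, Fin.sum_univ_succ]
    simp only [Fin.succ_last, ← Fin.succ_castSucc] at this ⊢
    rw [this]
    congr 1
    rcases N with _ | N
    · simp
    · simp [List.ofFn_succ]

theorem netCost_pathGraph {N : ℕ} (f : Fin (N + 1) → ℕ) (hf : f.Injective) :
    netCost (SimpleGraph.pathGraph (N + 1)) f + N =
      ∑ k : Fin N, ((f k.castSucc : ℤ) - (f k.succ : ℕ)).natAbs := by
  have hE : (SimpleGraph.pathGraph (N + 1)).edgeSet =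
      Set.range fun k : Fin N => s(k.castSucc, k.succ) := by
    ext e
    induction e using Sym2.ind with
    | _ a b =>
      simp only [SimpleGraph.mem_edgeSet, SimpleGraph.pathGraph_adj, Set.mem_range, Sym2.eq_iff,
        Fin.ext_iff, Fin.val_castSucc, Fin.val_succ]
      constructor
      · rintro (h | h)
        · exact ⟨⟨a, by omega⟩, Or.inl ⟨rfl, h⟩⟩
        · exact ⟨⟨b, by omega⟩, Or.inr ⟨rfl, h⟩⟩
      · rintro ⟨k, h | h⟩ <;> omega
  have hinj : Function.Injective fun k : Fin N => s(k.castSucc, k.succ) := by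
    intro k l h
    simp only [Sym2.eq_iff, Fin.ext_iff, Fin.val_castSucc, Fin.val_succ] at h
    ext; omega
  rw [netCost, hE, finsum_mem_range hinj, finsum_eq_sum_of_fintype]
  trans ∑ k : Fin N, (edgeLen f s(k.castSucc, k.succ) - 1 + 1)
  · simp [Finset.sum_add_distrib]
  refine Finset.sum_congr rfl fun k _ => ?_
  have hne : f k.castSucc ≠ f k.succ := fun h => by
    have := congrArg Fin.val (hf h)
    simp at this
  simp only [edgeLen, Sym2.lift_mk]
  omega

theorem sum_le_sum_map_fiber {ι κ : Type*} [DecidableEq κ] (B A : Finset ι) (hBA : B ⊆ A)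
    (c : ι → κ) (f : ι → ℝ) (hf : ∀ u, 0 ≤ f u) (L : List κ) (hL : ∀ u ∈ B, c u ∈ L) :
    ∑ u ∈ B, f u ≤ (L.map fun s => ∑ u ∈ A with c u = s, f u).sum := by
  induction L generalizing B with
  | nil =>
    have : B = ∅ := Finset.eq_empty_of_forall_notMem fun u hu => by simpa using hL u hu
    simp [this]
  | cons a L ih =>
    rw [List.map_cons, List.sum_cons, ← Finset.sum_filter_add_sum_filter_not B (fun u => c u = a)]
    refine add_le_add (Finset.sum_le_sum_of_subset_of_nonneg
      (Finset.filter_subset_filter _ hBA) fun u _ _ => hf u) (ih _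
      ((Finset.filter_subset _ _).trans hBA) fun u hu => ?_)
    rw [Finset.mem_filter] at hu
    have := hL u hu.1
    simp_all

/-- The factor contributed by a single threshold to `x ^ cost`. -/
noncomputable def gapWeight (x : ℝ) (s : List ℕ) : ℝ := x ^ boundaries s * x⁻¹

/-- The contribution of the thresholds `i, …, N` to `x ^ cost`. -/
noncomputable def tailWeight (x : ℝ) (N i : ℕ) (u : List ℕ) : ℝ :=
  ∏ k ∈ Finset.Ico i (N + 1), gapWeight x (collapse k u)

/-- The total tail weight of the words in `A` whose collapse at threshold `i` is `s`. -/
noncomputable def fiberWeight (A : Finset (List ℕ)) (x : ℝ) (N i : ℕ) (s : List ℕ) : ℝ :=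
  ∑ u ∈ A with collapse i u = s, tailWeight x N i u

/-- `u` lists the numbers `1, …, N` without repetition, starting with `j`. -/
structure IsWord (N j : ℕ) (u : List ℕ) : Prop where
  nodup : u.Nodup
  mem_iff : ∀ v, v ∈ u ↔ 1 ≤ v ∧ v ≤ N
  headD_eq : ∀ e, u.headD e = j

theorem gapWeight_nonneg {x : ℝ} (hx : 0 ≤ x) (s : List ℕ) : 0 ≤ gapWeight x s := by
  unfold gapWeight; positivity

theorem tailWeight_nonneg {x : ℝ} (hx : 0 ≤ x) (N i : ℕ) (u : List ℕ) :
    0 ≤ tailWeight x N i u :=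
  Finset.prod_nonneg fun _ _ => gapWeight_nonneg hx _

section Words

variable {A : Finset (List ℕ)} {N j : ℕ} {x : ℝ}

theorem sum_tailWeight_le (hA : ∀ u ∈ A, IsWord N j u) (hx : 0 ≤ x) {i : ℕ} (hi : i < N)
    (s : List ℕ) :
    ∑ u ∈ A with collapse i u = s, tailWeight x N (i + 1) u ≤
      ((extensions (i + 1) s).map (fiberWeight A x N (i + 1))).sum := by
  refine sum_le_sum_map_fiber _ A (Finset.filter_subset _ _) (collapse (i + 1)) _
    (fun u => tailWeight_nonneg hx _ _ _) _ fun u hu => ?_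
  rw [Finset.mem_filter] at hu
  rw [← hu.2]
  exact collapse_succ_mem_extensions (hA u hu.1).nodup (((hA u hu.1).mem_iff _).2 (by omega))

theorem fiberWeight_le (hA : ∀ u ∈ A, IsWord N j u) (hx : 0 ≤ x) {i : ℕ} (hi : i < N)
    (s : List ℕ) :
    fiberWeight A x N i s ≤
      gapWeight x s * ((extensions (i + 1) s).map (fiberWeight A x N (i + 1))).sum := by
  refine le_trans (le_of_eq ?_)
    (mul_le_mul_of_nonneg_left (sum_tailWeight_le hA hx hi s) (gapWeight_nonneg hx s))
  rw [fiberWeight, Finset.mul_sum]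
  refine Finset.sum_congr rfl fun u hu => ?_
  rw [Finset.mem_filter] at hu
  rw [tailWeight, Finset.prod_eq_prod_Ico_succ_bot (by omega), hu.2, tailWeight]

theorem fiberWeight_eq_zero (hA : ∀ u ∈ A, IsWord N j u) {i : ℕ} {s : List ℕ}
    (hs : startsWithLetter s ≠ if j ≤ i then 1 else 0) : fiberWeight A x N i s = 0 := by
  rw [fiberWeight, Finset.filter_false_of_mem, Finset.sum_empty]
  rintro u hu rfl
  apply hs
  rw [startsWithLetter_collapse (Nat.lt_succ_self i) fun a ha => (((hA u hu).mem_iff a).1 ha).1,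
    (hA u hu).headD_eq]

theorem fiberWeight_last_le (hA : ∀ u ∈ A, IsWord N j u) (hx : 0 < x) {s : List ℕ}
    (hs : startsWithLetter s = 1) :
    fiberWeight A x N N s ≤ if s.count 0 = 0 then 1 else 0 := by
  have hcol : ∀ u ∈ A, collapse N u = u := fun u hu =>
    collapse_eq_self fun a ha => (((hA u hu).mem_iff a).1 ha).2
  by_cases hsA : s ∈ A
  · have h0 : s.count 0 = 0 := List.count_eq_zero_of_not_mem fun h => by
      have := ((hA s hsA).mem_iff 0).1 h
      omega
    have : A.filter (fun u => collapse N u = s) = {s} := by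
      ext u
      simp only [Finset.mem_filter, Finset.mem_singleton]
      constructor
      · rintro ⟨hu, rfl⟩
        exact (hcol u hu).symm
      · rintro rfl
        exact ⟨hsA, hcol _ hsA⟩
    rw [fiberWeight, this, Finset.sum_singleton, tailWeight, Nat.Ico_succ_singleton,
      Finset.prod_singleton, hcol s hsA, gapWeight, boundaries, hs, if_pos h0, h0]
    simp [hx.ne']
  · rw [fiberWeight, Finset.filter_false_of_mem, Finset.sum_empty]
    · split_ifs <;> norm_num
    · rintro u hu rfl
      exact hsA (by rwa [hcol u hu])

/-- A supersolution of the transfer recursion for words collapsed above their first letter. -/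
noncomputable def upperBound : ℕ → ℝ
  | 0 => 1
  | 1 => 0.085
  | _ => 0.07

/-- A supersolution of the transfer recursion for words collapsed below their first letter. -/
noncomputable def lowerBound : ℕ → ℝ
  | 0 => 1
  | _ => 0.05

theorem upperBound_nonneg (m : ℕ) : 0 ≤ upperBound m := by
  unfold upperBound; split <;> norm_num

theorem succ_mul_pow_le_one {y : ℝ} (hy : 0 ≤ y) (hy' : y ≤ 1 / 2) (m : ℕ) :
    (m + 1) * y ^ m ≤ 1 := by
  induction m with
  | zero => simp
  | succ m ih =>
    have h := pow_nonneg hy m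
    have hm : (0 : ℝ) ≤ m := m.cast_nonneg
    calc ((m + 1 : ℕ) + 1 : ℝ) * y ^ (m + 1) = ((m + 2) * y) * y ^ m := by push_cast; ring
      _ ≤ (m + 1) * y ^ m := by gcongr; nlinarith
      _ ≤ 1 := ih

theorem upperBound_super {l : ℝ} (hx : 0 ≤ x) (hx' : x ≤ 0.2571) (hl : 1.085 ≤ l) (m : ℕ) :
    x ^ (2 * m) * (m * upperBound (m - 1) + (2 * m + 1) * upperBound m
      + (m + 1) * upperBound (m + 1)) ≤ l * upperBound m := by
  have hx2 : x ^ 2 ≤ 0.0662 := by nlinarith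
  have hx0 := sq_nonneg x
  rcases m with _ | _ | _ | m
  · norm_num [upperBound]; linarith
  · norm_num [upperBound]; nlinarith
  · norm_num [upperBound]; nlinarith [mul_nonneg hx0 hx0]
  · norm_num [upperBound]
    have h1 := succ_mul_pow_le_one hx (by linarith) (m + 3)
    have h2 : x ^ (m + 3) ≤ 0.1 :=
      (pow_le_pow_of_le_one hx (by linarith) (show 2 ≤ m + 3 by omega)).trans (by linarith)
    have h0 := pow_nonneg hx (m + 3)
    rw [mul_comm 2, pow_mul]
    push_cast at h1
    nlinarith

theorem lowerBound_super {l : ℝ} (hx : 0 ≤ x) (hx' : x ≤ 0.2571) (hl : 0.55 ≤ l) (p : ℕ) :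
    x ^ (2 * p + 1) * (p * lowerBound (p - 1) + (2 * p + 2) * lowerBound p
      + (p + 2) * lowerBound (p + 1)) ≤ l * lowerBound p := by
  have hx2 : x ^ 2 ≤ 0.0662 := by nlinarith
  have hx0 := sq_nonneg x
  rcases p with _ | _ | p
  · norm_num [lowerBound]; nlinarith
  · norm_num [lowerBound]
    have : x ^ 3 ≤ 0.0171 := by nlinarith
    nlinarith
  · norm_num [lowerBound]
    have h1 := succ_mul_pow_le_one hx (by linarith) (p + 2)
    have h2 : x ^ (p + 2) ≤ 0.1 :=
      (pow_le_pow_of_le_one hx (by linarith) (show 2 ≤ p + 2 by omega)).trans (by linarith)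
    have h0 := pow_nonneg hx (p + 2)
    rw [pow_succ x, mul_comm 2, pow_mul]
    push_cast at h1
    have h3 : x ^ (p + 2) * x ≤ 0.1 := by nlinarith
    have h4 : 0 ≤ x ^ (p + 2) * x := by positivity
    nlinarith

theorem fiberWeight_letter_le {l : ℝ} (hA : ∀ u ∈ A, IsWord N j u) (hx : 0 < x)
    (hx' : x ≤ 0.2571) (hl : 1.085 ≤ l) (d : ℕ) {i : ℕ} (hd : i + d = N) {s : List ℕ}
    (hs : startsWithLetter s = 1) :
    fiberWeight A x N i s ≤ l ^ d * upperBound (s.count 0) := by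
  induction d generalizing i s with
  | zero =>
    obtain rfl : i = N := hd
    refine (fiberWeight_last_le hA hx hs).trans ?_
    split_ifs with h
    · simp [h, upperBound]
    · simpa using upperBound_nonneg _
  | succ d ih =>
    obtain ⟨b, t, rfl⟩ : ∃ b t, s = (b + 1) :: t := by
      rcases s with _ | ⟨_ | b, t⟩
      · simp [startsWithLetter] at hs
      · simp [startsWithLetter] at hs
      · exact ⟨b, t, rfl⟩
    have hl0 : 0 ≤ l ^ d := pow_nonneg (by linarith) d
    have hw : gapWeight x ((b + 1) :: t) = x ^ (2 * ((b + 1) :: t).count 0) := by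
      rw [gapWeight, boundaries, hs, pow_succ, mul_inv_cancel_right₀ hx.ne']
    have hsum : ((extensions (i + 1) ((b + 1) :: t)).map (fiberWeight A x N (i + 1))).sum ≤
        ((extensions (i + 1) ((b + 1) :: t)).map fun r => l ^ d * upperBound (r.count 0)).sum := by
      refine List.sum_le_sum fun r hr => ih (by omega) ?_
      simp only [extensions, Nat.succ_ne_zero, if_false, List.nil_append, List.mem_map] at hr
      obtain ⟨r, -, rfl⟩ := hr
      rfl
    rw [sum_count_extensions (Nat.succ_ne_zero i) (fun m => l ^ d * upperBound m)] at hsum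
    calc _ ≤ _ := fiberWeight_le hA hx.le (by omega) _
      _ ≤ _ := mul_le_mul_of_nonneg_left hsum (gapWeight_nonneg hx.le _)
      _ = l ^ d * _ := by rw [hw]; ring
      _ ≤ l ^ d * _ := mul_le_mul_of_nonneg_left
        (upperBound_super hx.le hx' hl (((b + 1) :: t).count 0)) hl0
      _ = _ := by ring

theorem fiberWeight_gap_le {l μ : ℝ} (hA : ∀ u ∈ A, IsWord N j u) (hx : 0 < x)
    (hx' : x ≤ 0.2571) (hl : 1.085 ≤ l) (hμ : 0.55 ≤ μ) (hj : j ≤ N) (d : ℕ) {i : ℕ}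
    (hd : i + d + 1 = j) (r : List ℕ) :
    fiberWeight A x N i (0 :: r) ≤ μ ^ d * l ^ (N - j) * lowerBound (r.count 0) := by
  have hl0 : 0 ≤ l ^ (N - j) := pow_nonneg (by linarith) _
  have hstep : fiberWeight A x N i (0 :: r) ≤ x ^ (2 * r.count 0 + 1) *
      (fiberWeight A x N (i + 1) ((i + 1) :: r) + fiberWeight A x N (i + 1) ((i + 1) :: 0 :: r)
      + fiberWeight A x N (i + 1) (0 :: (i + 1) :: r)
      + fiberWeight A x N (i + 1) (0 :: (i + 1) :: 0 :: r)
      + ((extensions (i + 1) r).map fun t => fiberWeight A x N (i + 1) (0 :: t)).sum) := by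
    refine (fiberWeight_le hA hx.le (show i < N by omega) (0 :: r)).trans (le_of_eq ?_)
    congr 1
    · rw [gapWeight, boundaries, List.count_cons_self, mul_add_one, startsWithLetter, add_zero,
        pow_succ, mul_inv_cancel_right₀ hx.ne']
      simp
    · simp [extensions, Function.comp_def]; ring
  refine hstep.trans ?_
  rcases d with _ | d
  · have hz (t : List ℕ) : fiberWeight A x N (i + 1) (0 :: t) = 0 :=
      fiberWeight_eq_zero hA (by rw [if_pos (by omega)]; simp [startsWithLetter])
    have h1 := fiberWeight_letter_le hA hx hx' hl (N - j) (i := i + 1) (by omega)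
      (s := (i + 1) :: r) rfl
    have h2 := fiberWeight_letter_le hA hx hx' hl (N - j) (i := i + 1) (by omega)
      (s := (i + 1) :: 0 :: r) rfl
    simp only [List.count_cons_self, List.count_cons_of_ne (Nat.succ_ne_zero i)] at h1 h2
    simp only [hz, List.map_const', List.sum_replicate, smul_zero, add_zero, pow_zero, one_mul]
    have hsuper : x ^ (2 * r.count 0 + 1) * (upperBound (r.count 0) + upperBound (r.count 0 + 1)) ≤
        lowerBound (r.count 0) := by
      rcases r.count 0 with _ | _ | p
      · norm_num [upperBound, lowerBound]; linarith
      · norm_num [upperBound, lowerBound]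
        have : x ^ 3 ≤ 0.0171 := by nlinarith [sq_nonneg x]
        linarith
      · norm_num [upperBound, lowerBound]
        have : x ^ (2 * (p + 2) + 1) ≤ x ^ 1 :=
          pow_le_pow_of_le_one hx.le (by linarith) (by omega)
        rw [pow_one] at this
        linarith
    calc _ ≤ x ^ (2 * r.count 0 + 1) * (l ^ (N - j) * upperBound (r.count 0)
          + l ^ (N - j) * upperBound (r.count 0 + 1)) := by gcongr
      _ = l ^ (N - j) * (x ^ (2 * r.count 0 + 1) *
          (upperBound (r.count 0) + upperBound (r.count 0 + 1))) := by ring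
      _ ≤ _ := mul_le_mul_of_nonneg_left hsuper hl0
  · have hz (t : List ℕ) (ht : startsWithLetter t = 1) : fiberWeight A x N (i + 1) t = 0 :=
      fiberWeight_eq_zero hA (by rw [if_neg (by omega), ht]; simp)
    have hμ0 : 0 ≤ μ ^ d := pow_nonneg (by linarith) d
    have ih (t : List ℕ) := fiberWeight_gap_le hA hx hx' hl hμ hj d (i := i + 1) (by omega) t
    have h1 := ih ((i + 1) :: r)
    have h2 := ih ((i + 1) :: 0 :: r)
    have h3 : ((extensions (i + 1) r).map fun t => fiberWeight A x N (i + 1) (0 :: t)).sum ≤ _ :=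
      List.sum_le_sum fun t _ => ih t
    rw [sum_count_extensions (Nat.succ_ne_zero i)
      (fun p => μ ^ d * l ^ (N - j) * lowerBound p)] at h3
    simp only [List.count_cons_self, List.count_cons_of_ne (Nat.succ_ne_zero i)] at h1 h2
    rw [hz _ rfl, hz _ rfl]
    calc _ ≤ _ := mul_le_mul_of_nonneg_left (add_le_add (add_le_add (add_le_add_right h1 (0 + 0))
          h2) h3) (by positivity)
      _ = μ ^ d * l ^ (N - j) * _ := by ring
      _ ≤ μ ^ d * l ^ (N - j) * _ := mul_le_mul_of_nonneg_left
        (lowerBound_super hx.le hx' hμ (r.count 0)) (mul_nonneg hμ0 hl0)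
      _ = _ := by ring
termination_by d

theorem sum_tailWeight_le_pow {l μ : ℝ} (hA : ∀ u ∈ A, IsWord N j u) (hx : 0 < x)
    (hx' : x ≤ 0.2571) (hl : 1.085 ≤ l) (hμ : 0.55 ≤ μ) (hj0 : 1 ≤ j) (hj : j ≤ N) :
    ∑ u ∈ A, tailWeight x N 1 u ≤ 4 * μ ^ j * l ^ (N - j) := by
  have hl0 : 0 ≤ l ^ (N - j) := pow_nonneg (by linarith) _
  have h := sum_tailWeight_le hA hx.le (show 0 < N by omega) []
  rw [Finset.filter_true_of_mem fun u hu =>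
    collapse_zero fun a ha => (((hA u hu).mem_iff a).1 ha).1] at h
  refine h.trans ?_
  simp only [extensions, zero_add, List.map_cons, List.map_nil, List.sum_cons, List.sum_nil,
    add_zero]
  rcases hj0.eq_or_lt with rfl | hj1
  · have h1 := fiberWeight_letter_le hA hx hx' hl (N - 1) (i := 1) (by omega) (s := [1]) rfl
    have h2 : fiberWeight A x N 1 [0, 1] = 0 :=
      fiberWeight_eq_zero hA (by simp [startsWithLetter])
    simp only [List.count_cons, List.count_nil, upperBound] at h1
    rw [h2]
    norm_num [upperBound] at h1
    nlinarith
  · obtain ⟨d, rfl⟩ : ∃ d, j = d + 2 := ⟨j - 2, by omega⟩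
    have h1 := fiberWeight_gap_le hA hx hx' hl hμ hj d (i := 1) (by omega) [1]
    have h2 : fiberWeight A x N 1 [1] = 0 :=
      fiberWeight_eq_zero hA (by rw [if_neg (by omega)]; simp [startsWithLetter])
    norm_num [lowerBound] at h1
    rw [h2, zero_add]
    refine h1.trans (mul_le_mul_of_nonneg_right ?_ hl0)
    have : 0 ≤ μ ^ d := pow_nonneg (by linarith) d
    have hμ2 : 1 ≤ 4 * μ ^ 2 := by nlinarith
    rw [pow_add]
    nlinarith

theorem tailWeight_eq_pow (hx : 0 < x) {u : List ℕ} (hu : IsWord N j u) {c : ℕ}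
    (hc : c + N = walkLength (N + 1) u) : tailWeight x N 1 u = x ^ c := by
  simp only [tailWeight, gapWeight]
  rw [Finset.prod_mul_distrib, Finset.prod_pow_eq_pow_sum,
    sum_boundaries fun a ha => (hu.mem_iff a).1 ha, ← hc]
  simp [pow_add, hx.ne']

end Words

/-- The labels of all vertices of the path except the last one, in order. -/
def initialWord {N : ℕ} (α : Fin (N + 1) ≃ Fin (N + 1)) : List ℕ :=
  List.ofFn fun k : Fin N => (α k.castSucc : ℕ) + 1

theorem isWord_initialWord {N j : ℕ} (hN : 1 ≤ N) {α : Fin (N + 1) ≃ Fin (N + 1)}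
    (h0 : (α 0 : ℕ) + 1 = j) (hlast : α (Fin.last N) = Fin.last N) :
    IsWord N j (initialWord α) := by
  refine ⟨List.nodup_ofFn.2 fun a b h => ?_, fun v => ?_, fun e => ?_⟩
  · simpa [Fin.val_inj] using h
  · simp only [initialWord, List.mem_ofFn]
    constructor
    · rintro ⟨k, rfl⟩
      have h : α k.castSucc ≠ Fin.last N := fun h =>
        (Fin.castSucc_lt_last k).ne (α.injective (h.trans hlast.symm))
      have := Fin.val_lt_last h
      omega
    · rintro ⟨h1, h2⟩
      have hne : α.symm ⟨v - 1, by omega⟩ ≠ Fin.last N := fun h => by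
        rw [Equiv.symm_apply_eq, hlast, Fin.ext_iff] at h
        simp at h; omega
      refine ⟨(α.symm ⟨v - 1, by omega⟩).castPred hne, ?_⟩
      simp; omega
  · obtain ⟨M, rfl⟩ : ∃ M, N = M + 1 := ⟨N - 1, by omega⟩
    simp [initialWord, List.ofFn_succ, h0]

theorem initialWord_injOn (N : ℕ) :
    Set.InjOn initialWord {α : Fin (N + 1) ≃ Fin (N + 1) | α (Fin.last N) = Fin.last N} := by
  intro α hα β hβ h
  ext k
  induction k using Fin.lastCases with
  | last => rw [hα, hβ]
  | cast k =>
    have := congrFun (List.ofFn_injective h) k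
    simpa using this

theorem netCost_add_eq_walkLength {N : ℕ} {α : Fin (N + 1) ≃ Fin (N + 1)}
    (hlast : α (Fin.last N) = Fin.last N) :
    netCost (SimpleGraph.pathGraph (N + 1)) (fun v => (α v : ℕ) + 1) + N =
      walkLength (N + 1) (initialWord α) := by
  rw [netCost_pathGraph _ fun a b h => by simpa [Fin.val_inj] using h,
    ← walkLength_ofFn fun v => (α v : ℕ) + 1]
  simp [hlast, initialWord]

theorem card_arrangements_le {N k j : ℕ} {x l μ : ℝ} (hx : 0 < x) (hx' : x ≤ 0.2571)
    (hl : 1.085 ≤ l) (hμ : 0.55 ≤ μ) (hj0 : 1 ≤ j) (hj : j ≤ N) :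
    (Nat.card {α : Fin (N + 1) ≃ Fin (N + 1) //
        netCost (SimpleGraph.pathGraph (N + 1)) (fun v => (α v : ℕ) + 1) ≤ k ∧
        (α 0 : ℕ) + 1 = j ∧ α (Fin.last N) = Fin.last N} : ℝ) * x ^ k ≤
      4 * μ ^ j * l ^ (N - j) := by
  classical
  rw [Nat.card_eq_fintype_card, Fintype.card_subtype]
  set S := Finset.univ.filter fun α : Fin (N + 1) ≃ Fin (N + 1) =>
    netCost (SimpleGraph.pathGraph (N + 1)) (fun v => (α v : ℕ) + 1) ≤ k ∧
      (α 0 : ℕ) + 1 = j ∧ α (Fin.last N) = Fin.last N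
  have hS : ∀ α ∈ S, netCost (SimpleGraph.pathGraph (N + 1)) (fun v => (α v : ℕ) + 1) ≤ k ∧
      (α 0 : ℕ) + 1 = j ∧ α (Fin.last N) = Fin.last N := fun α hα => (Finset.mem_filter.1 hα).2
  have hword : ∀ u ∈ S.image initialWord, IsWord N j u := by
    intro u hu
    obtain ⟨α, hα, rfl⟩ := Finset.mem_image.1 hu
    exact isWord_initialWord (by omega) (hS α hα).2.1 (hS α hα).2.2
  refine le_trans ?_ (sum_tailWeight_le_pow hword hx hx' hl hμ hj0 hj)
  rw [Finset.sum_image ((initialWord_injOn N).mono fun α hα => (hS α hα).2.2), ← nsmul_eq_mul]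
  refine Finset.card_nsmul_le_sum _ _ _ fun α hα => ?_
  rw [tailWeight_eq_pow hx (hword _ (Finset.mem_image_of_mem _ hα))
    (netCost_add_eq_walkLength (hS α hα).2.2)]
  exact pow_le_pow_of_le_one hx.le (by linarith) (hS α hα).1

end PathArrangement

theorem path_arrangement_count_bound (n k j : ℕ) (hn : 2 ≤ n) (hj : j ≤ n - 1) :
    (Nat.card {α : Fin n ≃ Fin n //
        netCost (SimpleGraph.pathGraph n) (fun v => (α v : ℕ) + 1) ≤ k ∧
        (α ⟨0, by omega⟩ : ℕ) + 1 = j ∧ (α ⟨n - 1, by omega⟩ : ℕ) + 1 = n} : ℝ) ≤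
      2 ^ ((0.119 : ℝ) * n + 1.96 * k - 0.967095 * j + 2) := by
  obtain ⟨N, rfl⟩ : ∃ N, n = N + 1 := ⟨n - 1, by omega⟩
  rcases j.eq_zero_or_pos with rfl | hj0
  · have : IsEmpty {α : Fin (N + 1) ≃ Fin (N + 1) //
        netCost (SimpleGraph.pathGraph (N + 1)) (fun v => (α v : ℕ) + 1) ≤ k ∧
        (α ⟨0, by omega⟩ : ℕ) + 1 = 0 ∧ (α ⟨N + 1 - 1, by omega⟩ : ℕ) + 1 = N + 1} :=
      ⟨fun α => by have := α.2.2.1; omega⟩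
    rw [Nat.card_of_isEmpty, Nat.cast_zero]
    positivity
  have h2 : (0 : ℝ) < 2 := two_pos
  have hx : (2 : ℝ) ^ (-1.96 : ℝ) ≤ 0.2571 := by
    refine le_of_pow_le_pow_left₀ (n := 25) (by norm_num) (by norm_num) ?_
    rw [← Real.rpow_mul_natCast h2.le, show (-1.96 : ℝ) * (25 : ℕ) = ((-49 : ℤ) : ℝ) by norm_num,
      Real.rpow_intCast]
    norm_num
  have hl : (1.085 : ℝ) ≤ 2 ^ (0.119 : ℝ) := by
    refine le_trans ?_ (Real.rpow_le_rpow_of_exponent_le one_le_two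
      (show (7 / 59 : ℝ) ≤ 0.119 by norm_num))
    refine le_of_pow_le_pow_left₀ (n := 59) (by norm_num) (by positivity) ?_
    rw [← Real.rpow_mul_natCast h2.le, show (7 / 59 : ℝ) * (59 : ℕ) = (7 : ℕ) by norm_num,
      Real.rpow_natCast]
    norm_num
  have hμ : (0.55 : ℝ) ≤ 2 ^ (0.119 - 0.967095 : ℝ) := by
    refine le_trans ?_ (Real.rpow_le_rpow_of_exponent_le one_le_two
      (show (-17 / 20 : ℝ) ≤ 0.119 - 0.967095 by norm_num))
    refine le_of_pow_le_pow_left₀ (n := 20) (by norm_num) (by positivity) ?_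
    rw [← Real.rpow_mul_natCast h2.le, show (-17 / 20 : ℝ) * (20 : ℕ) = ((-17 : ℤ) : ℝ) by norm_num,
      Real.rpow_intCast]
    norm_num
  have hjN : j ≤ N := hj
  have h := PathArrangement.card_arrangements_le (k := k) (Real.rpow_pos_of_pos h2 _) hx hl hμ
    hj0 hjN
  have hlast (α : Fin (N + 1) ≃ Fin (N + 1)) :
      (α ⟨N + 1 - 1, by omega⟩ : ℕ) + 1 = N + 1 ↔ α (Fin.last N) = Fin.last N := by
    rw [Fin.ext_iff]
    exact Nat.add_right_cancel_iff
  simp only [hlast]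
  rw [← le_div_iff₀ (by positivity)] at h
  refine h.trans ?_
  rw [div_le_iff₀ (by positivity), ← Real.rpow_mul_natCast h2.le, ← Real.rpow_mul_natCast h2.le,
    ← Real.rpow_mul_natCast h2.le, Nat.cast_sub hjN, ← Real.rpow_add h2,
    show (4 : ℝ) = 2 ^ (2 : ℝ) by norm_num, ← Real.rpow_add h2, ← Real.rpow_add h2]
  refine Real.rpow_le_rpow_of_exponent_le one_le_two ?_
  push_cast
  linarith
end

section
/- For every tree T on n ≥ 2 vertices, every k ≥ 0, and every vertex set X ⊆ V(T) with |X| = i ≤ 3, the number of linear arrangements α of T with net cost at most k and α(x) ∈ {1,n} for all x ∈ X is at most 2^{0.119 n + 1.96 k − 1.4625 i + 4}. -/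
open scoped BigOperators

namespace TreeArrangement

open Finset

section

open scoped Classical

/-- The net cost of the part of `G` induced on `S`, each edge being counted from its left end. -/
noncomputable def costOn {V : Type*} (G : SimpleGraph V) (S : Finset V) (α : V → ℕ) : ℕ :=
  ∑ a ∈ S, ∑ b ∈ S, if G.Adj a b ∧ α a < α b then α b - α a - 1 else 0

/-- The net cost of a labelling of a finite graph, as a sum over pairs of vertices. -/
noncomputable def cost {V : Type*} [Finite V] (G : SimpleGraph V) (α : V → ℕ) : ℕ :=
  costOn G Set.finite_univ.toFinset α

lemma cost_eq_costOn {V : Type*} [Fintype V] (G : SimpleGraph V) (α : V → ℕ) :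
    cost G α = costOn G univ α := by
  unfold cost
  congr 1
  ext
  simp

lemma cost_le_netCost {V : Type*} [Finite V] (G : SimpleGraph V)
    (α : V ≃ Fin (Nat.card V)) : cost G (fun v => (α v : ℕ)) ≤ netCost G (arr α) := by
  have := Fintype.ofFinite V
  rw [cost_eq_costOn, costOn, ← sum_product', ← sum_filter, netCost,
    finsum_mem_eq_finite_toFinset_sum _ (Set.toFinite G.edgeSet)]
  set P := ((univ : Finset V) ×ˢ (univ : Finset V)).filter
    (fun p : V × V => G.Adj p.1 p.2 ∧ (α p.1 : ℕ) < α p.2) with hP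
  have hmem : ∀ p, p ∈ P ↔ G.Adj p.1 p.2 ∧ (α p.1 : ℕ) < α p.2 := by
    intro p
    simp [hP]
  have hinj : Set.InjOn (fun p : V × V => s(p.1, p.2)) P := by
    rintro ⟨a, b⟩ h1 ⟨c, d⟩ h2 h
    have h1 := (hmem _).1 h1
    have h2 := (hmem _).1 h2
    simp only [Sym2.eq_iff] at h
    rcases h with ⟨rfl, rfl⟩ | ⟨rfl, rfl⟩
    · rfl
    · exact absurd h1.2 (not_lt.2 h2.2.le)
  have h1 : ∑ p ∈ P, ((α p.2 : ℕ) - α p.1 - 1) =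
      ∑ e ∈ P.image (fun p : V × V => s(p.1, p.2)), (edgeLen (arr α) e - 1) := by
    rw [sum_image hinj]
    refine sum_congr rfl fun p hp => ?_
    have := ((hmem _).1 hp).2
    simp only [edgeLen, Sym2.lift_mk, arr]
    omega
  rw [h1]
  refine sum_le_sum_of_subset ?_
  intro e he
  obtain ⟨p, hp, rfl⟩ := mem_image.1 he
  simpa using ((hmem _).1 hp).1

lemma costOn_eq_of_leaf {V : Type*} (G : SimpleGraph V) (S : Finset V) (α : V → ℕ) {u v : V}
    (hv : v ∈ S) (hu : u ∈ S) (h : ∀ b ∈ S, G.Adj v b ↔ b = u) (hα : α v ≠ α u) :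
    costOn G S α = (if α v < α u then α u - α v - 1 else α v - α u - 1)
      + costOn G (S.erase v) α := by
  have huv : u ≠ v := by
    rintro rfl
    exact hα rfl
  have key : ∀ f : V → V → ℕ, ∑ a ∈ S, ∑ b ∈ S, f a b =
      (f v v + ∑ b ∈ S.erase v, (f v b + f b v)) + ∑ a ∈ S.erase v, ∑ b ∈ S.erase v, f a b := by
    intro f
    rw [← add_sum_erase _ _ hv, ← add_sum_erase _ _ hv]
    have : ∀ a ∈ S.erase v, ∑ b ∈ S, f a b = f a v + ∑ b ∈ S.erase v, f a b :=
      fun a _ => (add_sum_erase _ _ hv).symm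
    rw [sum_congr rfl this, sum_add_distrib, sum_add_distrib]
    ring
  rw [costOn, key, costOn]
  congr 1
  rw [sum_eq_single_of_mem u (mem_erase.2 ⟨huv, hu⟩)]
  · have h1 : G.Adj v u := (h u hu).2 rfl
    have h2 : G.Adj u v := h1.symm
    simp only [h1, h2, SimpleGraph.irrefl, true_and, false_and, if_false, zero_add]
    split_ifs <;> omega
  · intro b hb hbu
    have hb' := (mem_erase.1 hb).2
    have h1 : ¬ G.Adj v b := fun h' => hbu ((h b hb').1 h')
    have h2 : ¬ G.Adj b v := fun h' => h1 h'.symm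
    simp [h1, h2]

/-- Inserting a new vertex at position `s` stretches every edge spanning that position. -/
lemma costOn_add_card_le {V : Type*} (G : SimpleGraph V) (S : Finset V) (α β : V → ℕ) (s : ℕ)
    (h : ∀ a ∈ S, α a = if β a < s then β a else β a + 1) :
    costOn G S β + #{p ∈ S ×ˢ S | G.Adj p.1 p.2 ∧ α p.1 < s ∧ s < α p.2} ≤ costOn G S α := by
  rw [costOn, costOn, ← sum_product', ← sum_product', card_filter, ← sum_add_distrib]
  refine sum_le_sum fun p hp => ?_
  obtain ⟨h1, h2⟩ := mem_product.1 hp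
  have h1 := h _ h1
  have h2 := h _ h2
  by_cases hadj : G.Adj p.1 p.2
  · simp only [hadj, true_and]
    split_ifs at * <;> omega
  · simp [hadj]

lemma cost_induce {V : Type*} [Fintype V] (G : SimpleGraph V) (v : V)
    (β : ({v}ᶜ : Set V) → ℕ) (β' : V → ℕ) (h : ∀ w, β' w.1 = β w) :
    cost (G.induce {v}ᶜ) β = costOn G (univ.erase v) β' := by
  have key : ∀ f : V → ℕ, ∑ a ∈ univ.erase v, f a = ∑ a : ({v}ᶜ : Set V), f a.1 := by
    intro f
    refine (sum_subtype (univ.erase v) (p := fun a => a ∈ ({v}ᶜ : Set V)) ?_ f)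
    intro x
    simp
  rw [cost_eq_costOn, costOn, costOn, key]
  refine sum_congr rfl fun a _ => ?_
  rw [key]
  refine sum_congr rfl fun b _ => ?_
  simp [h]

lemma exists_adj_mem_notMem {V : Type*} {G : SimpleGraph V} (hG : G.Connected) (S : Set V)
    {a b : V} (ha : a ∈ S) (hb : b ∉ S) : ∃ c d, c ∈ S ∧ d ∉ S ∧ G.Adj c d := by
  obtain ⟨p⟩ := hG a b
  obtain ⟨d, -, h1, h2⟩ := p.exists_boundary_dart S ha hb
  exact ⟨_, _, h1, h2, d.adj⟩

/-- The arrangement obtained by deleting the vertex `v` and closing up the gap. -/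
noncomputable def remove {V : Type*} {m : ℕ} (v : V) (α : V ≃ Fin (m + 1)) :
    ({v}ᶜ : Set V) ≃ Fin m :=
  (α.subtypeEquiv (p := fun w => w ∈ ({v}ᶜ : Set V)) (q := fun i => i ≠ α v) (by simp)).trans
    (finSuccAboveEquiv (α v)).symm

lemma succAbove_remove {V : Type*} {m : ℕ} (v : V) (α : V ≃ Fin (m + 1)) (w : ({v}ᶜ : Set V)) :
    (α v).succAbove (remove v α w) = α w := by
  have := congrArg Subtype.val ((finSuccAboveEquiv (α v)).apply_symm_apply
    (α.subtypeEquiv (p := fun w => w ∈ ({v}ᶜ : Set V)) (q := fun i => i ≠ α v) (by simp) w))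
  rw [finSuccAboveEquiv_apply] at this
  exact this

lemma val_eq_remove {V : Type*} {m : ℕ} (v : V) (α : V ≃ Fin (m + 1)) (w : ({v}ᶜ : Set V)) :
    (α w : ℕ) = if (remove v α w : ℕ) < α v then (remove v α w : ℕ) else remove v α w + 1 := by
  rw [← succAbove_remove v α w, Fin.succAbove]
  simp only [Fin.lt_def, Fin.val_castSucc]
  split_ifs <;> simp

lemma remove_injective {V : Type*} {m : ℕ} (v : V) :
    Function.Injective (fun α : V ≃ Fin (m + 1) => (remove v α, α v)) := by
  intro α α' h
  simp only [Prod.mk.injEq] at h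
  ext w
  by_cases hw : w = v
  · rw [hw, h.2]
  · have h1 := val_eq_remove v α ⟨w, hw⟩
    have h2 := val_eq_remove v α' ⟨w, hw⟩
    rw [h.1, h.2] at h1
    exact h1.trans h2.symm

/-- Summation over all arrangements of `V` in `n` places. -/
noncomputable def arrSum (V : Type*) [Finite V] (n : ℕ) (f : (V ≃ Fin n) → ℝ) : ℝ :=
  ∑ α ∈ (Set.finite_univ (α := V ≃ Fin n)).toFinset, f α

lemma arrSum_eq (V : Type*) [Finite V] (n : ℕ) [Fintype (V ≃ Fin n)] (f : (V ≃ Fin n) → ℝ) :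
    arrSum V n f = ∑ α, f α := by
  unfold arrSum
  congr 1
  ext
  simp

lemma arrSum_mono {V : Type*} [Finite V] {n : ℕ} {f g : (V ≃ Fin n) → ℝ} (h : ∀ α, f α ≤ g α) :
    arrSum V n f ≤ arrSum V n g :=
  sum_le_sum fun α _ => h α

lemma arrSum_add {V : Type*} [Finite V] {n : ℕ} (f g : (V ≃ Fin n) → ℝ) :
    arrSum V n (fun α => f α + g α) = arrSum V n f + arrSum V n g :=
  sum_add_distrib

lemma arrSum_mul {V : Type*} [Finite V] {n : ℕ} (c : ℝ) (f : (V ≃ Fin n) → ℝ) :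
    arrSum V n (fun α => c * f α) = c * arrSum V n f :=
  (mul_sum _ _ _).symm

lemma arrSum_comp {V : Type*} [Finite V] {n : ℕ} (e : (V ≃ Fin n) ≃ (V ≃ Fin n))
    (f : (V ≃ Fin n) → ℝ) : arrSum V n (fun α => f (e α)) = arrSum V n f := by
  have := Fintype.ofFinite (V ≃ Fin n)
  rw [arrSum_eq, arrSum_eq]
  exact Equiv.sum_comp e f

lemma arrSum_le_remove {V : Type*} [Finite V] {m : ℕ} (v : V) (f : (V ≃ Fin (m + 1)) → ℝ)
    (g : (({v}ᶜ : Set V) ≃ Fin m) → ℕ → ℝ) (hg : ∀ β s, 0 ≤ g β s)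
    (h : ∀ α, f α ≤ g (remove v α) (α v)) :
    arrSum V (m + 1) f ≤ arrSum ({v}ᶜ : Set V) m (fun β => ∑ s ∈ range (m + 1), g β s) := by
  have := Fintype.ofFinite (V ≃ Fin (m + 1))
  have := Fintype.ofFinite (({v}ᶜ : Set V) ≃ Fin m)
  rw [arrSum_eq, arrSum_eq]
  simp_rw [← Fin.sum_univ_eq_sum_range]
  rw [← Fintype.sum_prod_type' (f := fun β (s : Fin (m + 1)) => g β s)]
  calc ∑ α, f α ≤ ∑ α, g (remove v α) (α v) := sum_le_sum fun α _ => h α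
    _ = ∑ p ∈ univ.image (fun α : V ≃ Fin (m + 1) => (remove v α, α v)), g p.1 p.2 := by
        rw [sum_image (remove_injective v).injOn]
    _ ≤ _ := sum_le_sum_of_subset_of_nonneg (subset_univ _) fun p _ _ => hg _ _

/-- A lower bound for the cost of inserting, at position `s` of an arrangement with `m` vertices,
a new leaf attached to the vertex at position `p`. -/
def insertCost (m p s : ℕ) : ℕ :=
  (if s ≤ p then p - s else s - p - 1) + (if s = 0 ∨ s = m then 0 else 1)

lemma cost_remove_leaf {V : Type*} [Finite V] {G : SimpleGraph V} (hG : G.Connected) {u v : V}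
    (hl : ∀ b, G.Adj v b ↔ b = u) (hu : u ∈ ({v}ᶜ : Set V)) {m : ℕ} (α : V ≃ Fin (m + 1)) :
    cost (G.induce {v}ᶜ) (fun w => (remove v α w : ℕ)) + insertCost m (remove v α ⟨u, hu⟩) (α v)
      ≤ cost G (fun w => (α w : ℕ)) := by
  have := Fintype.ofFinite V
  set β' : V → ℕ := fun w => if h : w ∈ ({v}ᶜ : Set V) then (remove v α ⟨w, h⟩ : ℕ) else 0 with hβ'
  have hββ : ∀ w : ({v}ᶜ : Set V), β' w.1 = remove v α w := fun w => by
    simp only [hβ', dif_pos w.2]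
  have hval : ∀ a ∈ univ.erase v, (α a : ℕ) = if β' a < α v then β' a else β' a + 1 := by
    intro a ha
    have ha' : a ∈ ({v}ᶜ : Set V) := by simpa using ha
    have := val_eq_remove v α ⟨a, ha'⟩
    rwa [← hββ ⟨a, ha'⟩] at this
  have huv : u ≠ v := hu
  have hne : ∀ a, a ≠ v → (α a : ℕ) ≠ α v := fun a ha h => ha (α.injective (Fin.ext h))
  rw [cost_induce G v _ β' hββ, cost_eq_costOn,
    costOn_eq_of_leaf G univ _ (mem_univ v) (mem_univ u) (fun b _ => hl b) (hne u huv).symm]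
  have h1 := costOn_add_card_le G (univ.erase v) (fun w => (α w : ℕ)) β' (α v) hval
  have hup := hval u (by simpa using huv)
  rw [← hββ ⟨u, hu⟩]
  have hcard : (α v : ℕ) ≠ 0 → (α v : ℕ) ≠ m → 1 ≤ #{p ∈ univ.erase v ×ˢ univ.erase v |
      G.Adj p.1 p.2 ∧ (α p.1 : ℕ) < α v ∧ (α v : ℕ) < α p.2} := by
    intro h0 hm
    have hlt := (α v).isLt
    suffices h : ∃ c d, c ≠ v ∧ d ≠ v ∧ G.Adj c d ∧ (α c : ℕ) < α v ∧ (α v : ℕ) < α d by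
      obtain ⟨c, d, h⟩ := h
      refine card_pos.2 ⟨(c, d), ?_⟩
      simpa [and_assoc] using h
    rcases lt_or_gt_of_ne (hne u huv) with h | h
    · obtain ⟨c, d, hc, hd, hcd⟩ := exists_adj_mem_notMem hG {a | (α v : ℕ) < α a}
        (a := α.symm (Fin.last m)) (b := v)
        (by rw [Set.mem_ofPred_eq, Equiv.apply_symm_apply, Fin.val_last]; omega) (by simp)
      simp only [Set.mem_ofPred_eq] at hc hd
      have hdv : d ≠ v := by
        rintro rfl
        rw [(hl c).1 hcd.symm] at hc
        omega
      refine ⟨d, c, hdv, ?_, hcd.symm, ?_, hc⟩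
      · rintro rfl
        omega
      · have := hne d hdv
        omega
    · obtain ⟨c, d, hc, hd, hcd⟩ := exists_adj_mem_notMem hG {a | (α a : ℕ) < α v}
        (a := α.symm 0) (b := v)
        (by rw [Set.mem_ofPred_eq, Equiv.apply_symm_apply, Fin.val_zero]; omega) (by simp)
      simp only [Set.mem_ofPred_eq] at hc hd
      have hdv : d ≠ v := by
        rintro rfl
        rw [(hl c).1 hcd.symm] at hc
        omega
      refine ⟨c, d, ?_, hdv, hcd, hc, ?_⟩
      · rintro rfl
        omega
      · have := hne d hdv
        omega
  simp only [insertCost]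
  generalize #{p ∈ univ.erase v ×ˢ univ.erase v |
      G.Adj p.1 p.2 ∧ (α p.1 : ℕ) < α v ∧ (α v : ℕ) < α p.2} = K at *
  split_ifs at * <;> omega

lemma exists_two_leaves {V : Type*} [Finite V] [Nontrivial V] {G : SimpleGraph V}
    (hG : G.IsTree) : ∃ v u v' u', v ≠ v' ∧ (∀ b, G.Adj v b ↔ b = u) ∧
      (∀ b, G.Adj v' b ↔ b = u') := by
  have := Fintype.ofFinite V
  obtain ⟨v, v', hne, h1, h2⟩ := hG.exists_ne_and_degree_eq_one
  obtain ⟨u, hu, hu'⟩ := SimpleGraph.degree_eq_one_iff_existsUnique_adj.1 h1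
  obtain ⟨w, hw, hw'⟩ := SimpleGraph.degree_eq_one_iff_existsUnique_adj.1 h2
  refine ⟨v, u, v', w, hne, fun b => ⟨hu' b, ?_⟩, fun b => ⟨hw' b, ?_⟩⟩
  · rintro rfl
    exact hu
  · rintro rfl
    exact hw

lemma isTree_remove {V : Type*} [Finite V] {G : SimpleGraph V} (hG : G.IsTree) {v u : V}
    (hl : ∀ b, G.Adj v b ↔ b = u) : (G.induce {v}ᶜ).IsTree := by
  have := Fintype.ofFinite V
  refine ⟨hG.connected.induce_compl_singleton_of_degree_eq_one (v := v) ?_,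
    hG.isAcyclic.induce _⟩
  rw [SimpleGraph.degree_eq_one_iff_existsUnique_adj]
  exact ⟨u, (hl u).2 rfl, fun b hb => (hl b).1 hb⟩

lemma card_compl_singleton {V : Type*} [Finite V] {m : ℕ} (h : Nat.card V = m + 1) (v : V) :
    Nat.card ({v}ᶜ : Set V) = m := by
  have := Set.ncard_compl ({v} : Set V)
  rw [Set.ncard_singleton] at this
  rw [Nat.card_coe_set_eq]
  omega

lemma ne_of_leaf {V : Type*} {G : SimpleGraph V} {u v : V}
    (hl : ∀ b, G.Adj v b ↔ b = u) : u ≠ v := ((hl u).2 rfl).ne'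

lemma degree_of_leaves {V : Type*} [Fintype V] [Nontrivial V] {G : SimpleGraph V}
    (hG : G.IsTree) {x y : V} (hxy : x ≠ y)
    (h : ∀ v u, (∀ b, G.Adj v b ↔ b = u) → v = x ∨ v = y) :
    G.degree x = 1 ∧ ∀ v, v ≠ x → v ≠ y → G.degree v = 2 := by
  have hpos : ∀ v, 0 < G.degree v :=
    fun v => hG.connected.preconnected.degree_pos_of_nontrivial v
  have htwo : ∀ v, 2 ≤ G.degree v + ((if v = x then 1 else 0) + if v = y then 1 else 0) := by
    intro v
    have h1 : G.degree v = 1 → v = x ∨ v = y := by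
      intro h1
      obtain ⟨u, hu, hu'⟩ := SimpleGraph.degree_eq_one_iff_existsUnique_adj.1 h1
      refine h v u fun b => ⟨hu' b, ?_⟩
      rintro rfl
      exact hu
    have := hpos v
    split_ifs <;> first | omega | (by_contra hc; have := h1 (by omega); tauto)
  have hsum : ∑ v : V, 2 =
      ∑ v, (G.degree v + ((if v = x then 1 else 0) + if v = y then 1 else 0)) := by
    rw [sum_add_distrib, sum_add_distrib, G.sum_degrees_eq_twice_card_edges]
    have := hG.card_edgeFinset
    simp
    omega
  have heq := (sum_eq_sum_iff_of_le fun v _ => htwo v).1 hsum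
  constructor
  · have := heq x (mem_univ x)
    simp [hxy] at this
    omega
  · intro v hvx hvy
    have := heq v (mem_univ v)
    simp [hvx, hvy] at this
    omega

lemma even_card_of_symm {V : Type*} (P : Finset (V × V)) (h1 : ∀ p ∈ P, p.swap ∈ P)
    (h2 : ∀ p ∈ P, p.1 ≠ p.2) : Even #P := by
  rw [← ZMod.natCast_eq_zero_iff_even, card_eq_sum_ones, Nat.cast_sum]
  refine sum_involution (fun p _ => p.swap) (fun p _ => by decide) (fun p hp _ h => ?_) h1
    (fun p _ => p.swap_swap)
  exact h2 p hp (congrArg Prod.fst h).symm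

lemma sum_insertCost (z c₀ c₁ : ℝ) (p q : ℕ) :
    ∑ s ∈ range (p + q + 1 + 1), (if s = 0 then c₀ else if s = p + q + 1 then c₁ else 1) *
        z ^ insertCost (p + q + 1) p s =
      (∑ t ∈ range p, z ^ (t + 1) + c₀ * z ^ p) + (∑ t ∈ range q, z ^ (t + 1) + c₁ * z ^ q) := by
  rw [show p + q + 1 + 1 = (p + 1) + (q + 1) by ring, sum_range_add, sum_range_succ',
    sum_range_succ _ q]
  congr 1
  · congr 1
    · rw [← sum_range_reflect (fun t => z ^ (t + 1)) p]
      refine sum_congr rfl fun t ht => ?_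
      have := mem_range.1 ht
      rw [if_neg (by omega), if_neg (by omega), one_mul, insertCost, if_pos (by omega),
        if_neg (by omega)]
      congr 1
      omega
  · congr 1
    · refine sum_congr rfl fun t ht => ?_
      have := mem_range.1 ht
      rw [if_neg (by omega), if_neg (by omega), one_mul, insertCost]
      congr 1
      split_ifs <;> omega
    · rw [if_neg (by omega), if_pos (by omega), insertCost]
      congr 2
      split_ifs <;> omega

lemma sum_pow_succ_le {z : ℝ} (hz0 : 0 < z) (hz : z ≤ 0.2571) (p : ℕ) :
    ∑ t ∈ range p, z ^ (t + 1) ≤ 0.347 := by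
  have : ∑ t ∈ range p, z ^ (t + 1) ≤ 0.347 * (1 - z ^ p) := by
    induction p with
    | zero => simp
    | succ p ih =>
      rw [sum_range_succ, pow_succ]
      have := pow_pos hz0 p
      nlinarith
  have := pow_pos hz0 p
  linarith

lemma antitone_sum_pow_succ_add {z : ℝ} (hz0 : 0 < z) (hz : z ≤ 0.2571) :
    Antitone fun p : ℕ => ∑ t ∈ range p, z ^ (t + 1) + z ^ p := by
  refine antitone_nat_of_succ_le fun p => ?_
  simp only [sum_range_succ, pow_succ]
  have := pow_pos hz0 p
  nlinarith

lemma sum_pow_succ_add_le_one {z : ℝ} (hz0 : 0 < z) (hz : z ≤ 0.2571) (p : ℕ) :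
    ∑ t ∈ range p, z ^ (t + 1) + z ^ p ≤ 1 := by
  simpa using antitone_sum_pow_succ_add hz0 hz (Nat.zero_le p)

lemma sum_pow_succ_add_le_of_one_le {z : ℝ} (hz0 : 0 < z) (hz : z ≤ 0.2571) {p : ℕ}
    (hp : 1 ≤ p) : ∑ t ∈ range p, z ^ (t + 1) + z ^ p ≤ 0.515 := by
  have := antitone_sum_pow_succ_add hz0 hz hp
  norm_num [sum_range_succ] at this
  norm_num
  linarith

lemma sum_pow_succ_add_le_of_two_le {z : ℝ} (hz0 : 0 < z) (hz : z ≤ 0.2571) {p : ℕ}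
    (hp : 2 ≤ p) : ∑ t ∈ range p, z ^ (t + 1) + z ^ p ≤ 0.39 := by
  have := antitone_sum_pow_succ_add hz0 hz hp
  norm_num [sum_range_succ] at this
  norm_num
  nlinarith

/-- A lower bound for the cost of subdividing the first edge of a path, whose first two vertices
are placed at `0` and `p`, by a vertex at position `s`. -/
def subdivisionCost (p s : ℕ) : ℕ :=
  if s ≤ p then (if s = 1 then 0 else 2) else 2 * (s - p)

lemma sum_subdivisionCost_le {z : ℝ} (hz0 : 0 < z) (hz : z ≤ 0.2571) (p N : ℕ) :
    ∑ t ∈ range N, z ^ subdivisionCost (p + 1) (t + 1) * 1.1 ^ t ≤ 1.085 * 1.1 ^ p := by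
  have hz2 : z ^ 2 ≤ 0.0662 := by nlinarith
  have hz2' : 0 < z ^ 2 := by positivity
  have h1 : ∑ t ∈ range (p + 1), z ^ subdivisionCost (p + 1) (t + 1) * (1.1 : ℝ) ^ t
      ≤ 1.1 ^ p := by
    have h2 : ∀ M, M ≤ p → ∑ t ∈ range (M + 1), z ^ subdivisionCost (p + 1) (t + 1) * (1.1 : ℝ) ^ t
        ≤ 1.1 ^ M := by
      intro M
      induction M with
      | zero => simp [subdivisionCost]
      | succ M ih =>
        intro hM
        rw [sum_range_succ]
        have h3 := ih (by omega)
        have h4 : subdivisionCost (p + 1) (M + 1 + 1) = 2 := by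
          rw [subdivisionCost, if_pos (by omega), if_neg (by omega)]
        have h5 : (0 : ℝ) < 1.1 ^ M := by positivity
        rw [h4, pow_succ (1.1 : ℝ) M]
        nlinarith
    exact h2 p le_rfl
  have h2 : ∀ M, ∑ t ∈ range M, z ^ subdivisionCost (p + 1) (p + 1 + t + 1)
      * (1.1 : ℝ) ^ (p + 1 + t) ≤ 0.085 * 1.1 ^ p * (1 - (z ^ 2 * 1.1) ^ M) := by
    intro M
    induction M with
    | zero => simp
    | succ M ih =>
      rw [sum_range_succ]
      have h4 : subdivisionCost (p + 1) (p + 1 + M + 1) = 2 * (M + 1) := by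
        rw [subdivisionCost, if_neg (by omega)]
        omega
      have h5 : z ^ (2 * (M + 1)) * (1.1 : ℝ) ^ (p + 1 + M) =
          1.1 ^ p * (z ^ 2 * 1.1) ^ M * (z ^ 2 * 1.1) := by
        rw [pow_mul, pow_succ (z ^ 2), mul_pow, pow_add, pow_add, pow_one]
        ring
      rw [h4, h5, pow_succ (z ^ 2 * 1.1)]
      have h6 : 0 < (1.1 : ℝ) ^ p * (z ^ 2 * 1.1) ^ M := by positivity
      nlinarith
  have h3 : ∑ t ∈ range N, z ^ subdivisionCost (p + 1) (t + 1) * (1.1 : ℝ) ^ t ≤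
      ∑ t ∈ range (p + 1 + N), z ^ subdivisionCost (p + 1) (t + 1) * (1.1 : ℝ) ^ t :=
    sum_le_sum_of_subset_of_nonneg (range_subset_range.2 (by omega)) fun _ _ _ => by positivity
  rw [sum_range_add] at h3
  have h4 := h2 N
  have h5 : 0 < (1.1 : ℝ) ^ p * (z ^ 2 * 1.1) ^ N := by positivity
  nlinarith

lemma cost_remove_end {V : Type*} [Finite V] {G : SimpleGraph V} (hG : G.Connected)
    {x y u w : V} (hx : ∀ b, G.Adj x b ↔ b = u) (hu : ∀ b, G.Adj u b ↔ b = x ∨ b = w)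
    (hwx : w ∈ ({x}ᶜ : Set V)) (hyx : y ≠ x) (hyu : y ≠ u)
    (hdeg : ∀ v, v ≠ x → v ≠ y → Nat.card {b // G.Adj v b} = 2)
    {m : ℕ} (α : V ≃ Fin (m + 1)) (h0 : (α u : ℕ) = 0) (hm : (α y : ℕ) = m) :
    cost (G.induce {x}ᶜ) (fun v => (remove x α v : ℕ)) +
      subdivisionCost (remove x α ⟨w, hwx⟩) (α x) ≤
      cost G (fun v => (α (Equiv.swap x u v) : ℕ)) := by
  have := Fintype.ofFinite V
  set β' : V → ℕ := fun v => if h : v ∈ ({x}ᶜ : Set V) then (remove x α ⟨v, h⟩ : ℕ) else 0 with hβ'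
  have hββ : ∀ v : ({x}ᶜ : Set V), β' v.1 = remove x α v := fun v => by
    simp only [hβ', dif_pos v.2]
  have hux : u ≠ x := ne_of_leaf hx
  have hwx' : w ≠ x := hwx
  have hwu : w ≠ u := (show G.Adj u w from (hu w).2 (Or.inr rfl)).ne'
  have hval : ∀ a, a ≠ x → (α a : ℕ) = if β' a < α x then β' a else β' a + 1 := by
    intro a ha
    have := val_eq_remove x α ⟨a, ha⟩
    rwa [← hββ ⟨a, ha⟩] at this
  have hne : ∀ a, a ≠ x → (α a : ℕ) ≠ α x := fun a ha h => ha (α.injective (Fin.ext h))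
  set γ : V → ℕ := fun v => (α (Equiv.swap x u v) : ℕ) with hγ
  have hγx : γ x = 0 := by simp [hγ, h0]
  have hγu : γ u = α x := by simp [hγ]
  have hγo : ∀ a, a ≠ x → a ≠ u → γ a = α a := by
    intro a h1 h2
    simp [hγ, Equiv.swap_apply_of_ne_of_ne h1 h2]
  have hs0 : (α x : ℕ) ≠ 0 := fun h => hne u hux (by omega)
  have hu' := hval u hux
  have hw' := hval w hwx'
  have hβu : β' u = 0 := by split_ifs at hu' <;> omega
  have hw0 : (α w : ℕ) ≠ 0 := fun h => hwu (α.injective (Fin.ext (by omega)))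
  have hws := hne w hwx'
  have hβw : β' w ≠ 0 := fun h => by
    rw [h] at hw'
    split_ifs at hw' <;> omega
  have hγw := hγo w hwx' hwu
  have hγy := hγo y hyx hyu
  have hys := hne y hyx
  have hlt := (α x).isLt
  rw [cost_induce G x _ β' hββ, cost_eq_costOn, ← hββ ⟨w, hwx⟩,
    costOn_eq_of_leaf G univ γ (mem_univ x) (mem_univ u) (fun b _ => hx b) (by omega),
    costOn_eq_of_leaf G (univ.erase x) γ (v := u) (u := w) (by simpa using hux)
      (by simpa using hwx')
      (fun b hb => (hu b).trans (or_iff_right (by simpa using hb))) (by omega),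
    costOn_eq_of_leaf G (univ.erase x) β' (v := u) (u := w) (by simpa using hux)
      (by simpa using hwx')
      (fun b hb => (hu b).trans (or_iff_right (by simpa using hb))) (by omega)]
  set S := (univ.erase x).erase u with hS
  have hmem : ∀ a, a ∈ S ↔ a ≠ x ∧ a ≠ u := by
    intro a
    simp [hS, and_comm]
  have h1 := costOn_add_card_le G S γ β' (α x) (fun a ha => by
    obtain ⟨h1, h2⟩ := (hmem a).1 ha
    rw [hγo a h1 h2]
    exact hval a h1)
  set K := ({p ∈ S ×ˢ S | G.Adj p.1 p.2 ∧ γ p.1 < α x ∧ (α x : ℕ) < γ p.2} : Finset (V × V))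
    with hK
  have hKmem : ∀ c d, (c, d) ∈ K ↔
      (c ≠ x ∧ c ≠ u) ∧ (d ≠ x ∧ d ≠ u) ∧ G.Adj c d ∧ γ c < α x ∧ (α x : ℕ) < γ d := by
    intro c d
    simp only [hK, mem_filter, mem_product, hmem, and_assoc]
  have hright : (α w : ℕ) < α x → 1 ≤ #K := by
    intro hlt'
    obtain ⟨c, d, hc, hd, hcd⟩ := exists_adj_mem_notMem hG {a | (α x : ℕ) < γ a}
      (a := y) (b := x) (by rw [Set.mem_ofPred_eq]; omega) (by rw [Set.mem_ofPred_eq]; omega)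
    rw [Set.mem_ofPred_eq] at hc hd
    have hcx : c ≠ x := by
      rintro rfl
      omega
    have hcu : c ≠ u := by
      rintro rfl
      omega
    have hdx : d ≠ x := by
      rintro rfl
      exact hcu ((hx c).1 hcd.symm)
    have hdu : d ≠ u := by
      rintro rfl
      rcases (hu c).1 hcd.symm with h | h
      · exact hcx h
      · subst h
        omega
    have := hγo d hdx hdu
    have := hne d hdx
    exact card_pos.2 ⟨(d, c), (hKmem _ _).2 ⟨⟨hdx, hdu⟩, ⟨hcx, hcu⟩, hcd.symm, by omega, hc⟩⟩
  have hleft : (α x : ℕ) < α w → (α x : ℕ) ≠ 1 → 2 ≤ #K := by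
    intro hlt' h1
    set L := ({v : V | v ≠ x ∧ γ v < α x} : Finset V) with hL
    have hLmem : ∀ a, a ∈ L ↔ a ≠ x ∧ γ a < α x := by
      intro a
      simp [hL]
    have hLadj : ∀ c ∈ L, ∀ d, G.Adj c d → (c ≠ x ∧ c ≠ u) ∧ d ≠ x ∧ d ≠ u := by
      intro c hc d hcd
      obtain ⟨hcx, hc⟩ := (hLmem c).1 hc
      have hcu : c ≠ u := by
        rintro rfl
        omega
      refine ⟨⟨hcx, hcu⟩, ?_, ?_⟩
      · rintro rfl
        exact hcu ((hx c).1 hcd.symm)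
      · rintro rfl
        rcases (hu c).1 hcd.symm with h | h
        · exact hcx h
        · subst h
          omega
    have hLout : ∀ c ∈ L, ∀ d ∉ L, G.Adj c d → (c, d) ∈ K := by
      intro c hc d hd hcd
      obtain ⟨hc', hdx, hdu⟩ := hLadj c hc d hcd
      have := hγo d hdx hdu
      have := hne d hdx
      rw [hLmem] at hc hd
      refine (hKmem _ _).2 ⟨hc', ⟨hdx, hdu⟩, hcd, hc.2, ?_⟩
      have : ¬ γ d < α x := fun h => hd ⟨hdx, h⟩
      omega
    have hKpos : 0 < #K := by
      set t := α.symm ⟨1, by omega⟩ with ht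
      have hαt : (α t : ℕ) = 1 := by simp [ht]
      have htx : t ≠ x := by
        intro h
        rw [h] at hαt
        omega
      have htu : t ≠ u := by
        intro h
        rw [h] at hαt
        omega
      obtain ⟨c, d, hc, hd, hcd⟩ := exists_adj_mem_notMem hG (L : Set V) (a := t) (b := x)
        (by
          rw [mem_coe, hLmem, hγo t htx htu]
          exact ⟨htx, by omega⟩)
        (by simp [hLmem])
      exact card_pos.2 ⟨(c, d), hLout c hc d hd hcd⟩
    have hLcard : ∑ a ∈ L, #{b : V | G.Adj a b} = 2 * #L := by
      rw [mul_comm, ← smul_eq_mul]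
      refine sum_const_nat fun a ha => ?_
      have hax := ((hLmem a).1 ha)
      have hay : a ≠ y := by
        rintro rfl
        omega
      have := hdeg a hax.1 hay
      rwa [Nat.card_eq_fintype_card, Fintype.card_subtype] at this
    have hsplit : ∑ a ∈ L, #{b : V | G.Adj a b} =
        #{p ∈ L ×ˢ L | G.Adj p.1 p.2} + #K := by
      have hK' : K = {p ∈ L ×ˢ Lᶜ | G.Adj p.1 p.2} := by
        ext ⟨c, d⟩
        rw [hKmem, mem_filter, mem_product, mem_compl, hLmem, hLmem]
        constructor
        · rintro ⟨h1, h2, h3, h4, h5⟩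
          exact ⟨⟨⟨h1.1, h4⟩, fun h => lt_asymm h.2 h5⟩, h3⟩
        · rintro ⟨⟨h1, h2⟩, h3⟩
          exact (hKmem _ _).1 (hLout c ((hLmem c).2 h1) d (fun h => h2 ((hLmem d).1 h)) h3)
      rw [hK', card_filter, card_filter, sum_product, sum_product, ← sum_add_distrib]
      refine sum_congr rfl fun a _ => ?_
      rw [sum_add_sum_compl, card_filter]
    have heven : Even #{p ∈ L ×ˢ L | G.Adj p.1 p.2} := by
      refine even_card_of_symm _ ?_ ?_
      · rintro ⟨a, b⟩ h
        simp only [mem_filter, mem_product, Prod.swap] at h ⊢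
        exact ⟨h.1.symm, h.2.symm⟩
      · rintro ⟨a, b⟩ h
        exact (mem_filter.1 h).2.ne
    obtain ⟨j, hj⟩ := heven
    omega
  generalize #K = k at *
  simp only [subdivisionCost]
  rw [hγx, hγu, hγw, hβu]
  split_ifs at * <;> omega

lemma path_step {V : Type*} [Finite V] {G : SimpleGraph V} (hG : G.IsTree)
    (hn : 3 ≤ Nat.card V) {x y u : V} (hxy : x ≠ y)
    (h : ∀ v u, (∀ b, G.Adj v b ↔ b = u) → v = x ∨ v = y) (hx : ∀ b, G.Adj x b ↔ b = u) :
    y ≠ u ∧ ∃ w, w ≠ x ∧ (∀ b, G.Adj u b ↔ b = x ∨ b = w) ∧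
      ∀ v, v ≠ x → v ≠ y → Nat.card {b // G.Adj v b} = 2 := by
  have := Fintype.ofFinite V
  rw [Nat.card_eq_fintype_card] at hn
  have : Nontrivial V := Fintype.one_lt_card_iff_nontrivial.1 (by omega)
  have hdeg := (degree_of_leaves hG hxy h).2
  have hux : u ≠ x := ne_of_leaf hx
  have hadj : G.Adj u x := ((hx u).2 rfl).symm
  have hyu : y ≠ u := by
    rintro rfl
    have h1 := (degree_of_leaves hG hxy.symm fun v u hv => (h v u hv).symm).1
    obtain ⟨t, ht⟩ : ∃ t, t ∉ ({x, y} : Finset V) := by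
      by_contra! hc
      have := card_le_card (fun t _ => hc t : (univ : Finset V) ⊆ {x, y})
      have := card_le_two (a := x) (b := y)
      rw [card_univ] at *
      omega
    obtain ⟨c, d, hc, hd, hcd⟩ := exists_adj_mem_notMem hG.connected
      (({x, y} : Finset V) : Set V) (a := x) (b := t) (by simp) (by simpa using ht)
    simp only [coe_insert, coe_singleton, Set.mem_insert_iff, Set.mem_singleton_iff, not_or]
      at hc hd
    rcases hc with rfl | rfl
    · exact hd.2 ((hx d).1 hcd)
    · obtain ⟨t, -, ht⟩ := SimpleGraph.degree_eq_one_iff_existsUnique_adj.1 h1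
      exact hd.1 ((ht d hcd).trans (ht x hadj).symm)
  refine ⟨hyu, ?_⟩
  have h2 := hdeg u hux hyu.symm
  rw [← SimpleGraph.card_neighborFinset_eq_degree, card_eq_two] at h2
  obtain ⟨a, b, hab, hN⟩ := h2
  have hN' : ∀ c, G.Adj u c ↔ c = a ∨ c = b := by
    intro c
    rw [← SimpleGraph.mem_neighborFinset, hN]
    simp
  have hcard : ∀ v, v ≠ x → v ≠ y → Nat.card {b // G.Adj v b} = 2 := by
    intro v h1 h2
    rw [← hdeg v h1 h2, Nat.card_eq_fintype_card, ← SimpleGraph.card_neighborSet_eq_degree]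
    rfl
  rcases (hN' x).1 hadj with rfl | rfl
  · exact ⟨b, hab.symm, hN', hcard⟩
  · exact ⟨a, hab, fun c => (hN' c).trans or_comm, hcard⟩

lemma arrSum_le_one {V : Type*} [Finite V] {n : ℕ} {f : (V ≃ Fin n) → ℝ}
    (P : (V ≃ Fin n) → Prop) (h : ∀ α, f α ≤ if P α then 1 else 0)
    (hP : ∀ α α', P α → P α' → α = α') : arrSum V n f ≤ 1 := by
  have := Fintype.ofFinite (V ≃ Fin n)
  rw [arrSum_eq]
  refine (sum_le_sum fun α _ => h α).trans ?_
  rw [sum_boole]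
  have : #{α | P α} ≤ 1 := card_le_one.2 fun a ha b hb =>
    hP a b (mem_filter.1 ha).2 (mem_filter.1 hb).2
  exact_mod_cast this

lemma arrSum_le_remove_leaf {V : Type*} [Finite V] {G : SimpleGraph V} (hG : G.Connected)
    {u v : V} (hl : ∀ b, G.Adj v b ↔ b = u) (hu : u ∈ ({v}ᶜ : Set V)) {m : ℕ} {z : ℝ}
    (hz0 : 0 < z) (hz1 : z ≤ 1) (P : (V ≃ Fin (m + 1)) → Prop)
    (Q : (({v}ᶜ : Set V) ≃ Fin m) → Prop) [DecidablePred P] [DecidablePred Q] (c₀ c₁ : ℝ) (hc₀ : 0 ≤ c₀) (hc₁ : 0 ≤ c₁)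
    (h : ∀ α, P α → Q (remove v α) ∧ (1 ≤ c₀ ∨ (α v : ℕ) ≠ 0) ∧ (1 ≤ c₁ ∨ (α v : ℕ) ≠ m)) :
    arrSum V (m + 1) (fun α => if P α then z ^ cost G (fun w => (α w : ℕ)) else 0) ≤
      arrSum ({v}ᶜ : Set V) m (fun β => if Q β then
        z ^ cost (G.induce {v}ᶜ) (fun w => (β w : ℕ)) *
          ((∑ t ∈ range (β ⟨u, hu⟩), z ^ (t + 1) + c₀ * z ^ (β ⟨u, hu⟩ : ℕ)) +
            (∑ t ∈ range (m - 1 - β ⟨u, hu⟩), z ^ (t + 1) + c₁ * z ^ (m - 1 - β ⟨u, hu⟩ : ℕ)))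
        else 0) := by
  refine (arrSum_le_remove v _ (fun β s => if Q β then
    z ^ cost (G.induce {v}ᶜ) (fun w => (β w : ℕ)) *
      ((if s = 0 then c₀ else if s = m then c₁ else 1) * z ^ insertCost m (β ⟨u, hu⟩) s) else 0)
    ?_ ?_).trans ?_
  · intro β s
    split_ifs <;> positivity
  · intro α
    by_cases hP : P α
    · obtain ⟨h1, h2, h3⟩ := h α hP
      rw [if_pos hP, if_pos h1]
      have h4 : (1 : ℝ) ≤ if (α v : ℕ) = 0 then c₀ else if (α v : ℕ) = m then c₁ else 1 := by
        split_ifs with h5 h6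
        · tauto
        · tauto
        · exact le_rfl
      calc z ^ cost G (fun w => (α w : ℕ)) ≤ z ^ (cost (G.induce {v}ᶜ)
            (fun w => (remove v α w : ℕ)) + insertCost m (remove v α ⟨u, hu⟩) (α v)) :=
            pow_le_pow_of_le_one hz0.le hz1 (cost_remove_leaf hG hl hu α)
        _ = z ^ cost (G.induce {v}ᶜ) (fun w => (remove v α w : ℕ)) *
            (1 * z ^ insertCost m (remove v α ⟨u, hu⟩) (α v)) := by rw [pow_add, one_mul]
        _ ≤ _ := by gcongr
    · rw [if_neg hP]
      split_ifs <;> positivity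
  · refine arrSum_mono fun β => ?_
    by_cases hQ : Q β
    · simp only [if_pos hQ]
      rw [← mul_sum]
      have hlt := (β ⟨u, hu⟩).isLt
      obtain ⟨q, hq⟩ : ∃ q, m = β ⟨u, hu⟩ + q + 1 := ⟨m - 1 - β ⟨u, hu⟩, by omega⟩
      generalize (β ⟨u, hu⟩ : ℕ) = p at *
      have hs := sum_insertCost z c₀ c₁ p q
      rw [← hq] at hs
      rw [hs, show m - 1 - p = q by omega]
    · simp [hQ]

lemma cost_rev {V : Type*} [Finite V] (G : SimpleGraph V) {n : ℕ} (α : V ≃ Fin n) :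
    cost G (fun w => (α.trans Fin.revPerm w : ℕ)) = cost G (fun w => (α w : ℕ)) := by
  unfold cost costOn
  rw [sum_comm]
  refine sum_congr rfl fun a _ => sum_congr rfl fun b _ => ?_
  have h1 := (α a).isLt
  have h2 := (α b).isLt
  simp only [G.adj_comm b a, Equiv.trans_apply, Fin.revPerm_apply, Fin.val_rev]
  by_cases h : G.Adj a b
  · simp only [h, true_and]
    split_ifs <;> omega
  · simp [h]

lemma arrSum_last_eq {V : Type*} [Finite V] (G : SimpleGraph V) (z : ℝ) (x : V) (m : ℕ) :
    arrSum V (m + 1) (fun α => if (α x : ℕ) = m then z ^ cost G (fun w => (α w : ℕ)) else 0) =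
      arrSum V (m + 1)
        (fun α => if (α x : ℕ) = 0 then z ^ cost G (fun w => (α w : ℕ)) else 0) := by
  rw [← arrSum_comp (Equiv.equivCongr (Equiv.refl V) Fin.revPerm)]
  congr 1
  funext α
  have h1 : Equiv.equivCongr (Equiv.refl V) Fin.revPerm α = α.trans Fin.revPerm := rfl
  have h2 := (α x).isLt
  rw [h1, cost_rev]
  refine if_congr ?_ rfl rfl
  simp only [Equiv.trans_apply, Fin.revPerm_apply, Fin.val_rev]
  omega

universe u

lemma arrSum_path_le {z r : ℝ} (hz0 : 0 < z) (hz : z ≤ 0.2571) (hr : 1.085 ≤ r) (m : ℕ) :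
    ∀ {V : Type u} [Finite V] {G : SimpleGraph V} (_ : G.IsTree) (_ : Nat.card V = m + 2)
      {x y u : V} (_ : x ≠ y) (_ : ∀ v u, (∀ b, G.Adj v b ↔ b = u) → v = x ∨ v = y)
      (_ : ∀ b, G.Adj x b ↔ b = u),
    arrSum V (m + 2) (fun α => if (α x : ℕ) = 0 ∧ (α y : ℕ) = m + 1 then
      z ^ cost G (fun w => (α w : ℕ)) * 1.1 ^ ((α u : ℕ) - 1) else 0) ≤ r ^ m := by
  have hz1 : z ≤ 1 := hz.trans (by norm_num)
  induction m with
  | zero =>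
    intro V _ G hG hn x y u hxy h hx
    rw [pow_zero]
    refine arrSum_le_one (fun α => (α x : ℕ) = 0 ∧ (α y : ℕ) = 1) (fun α => ?_) ?_
    · by_cases hα : (α x : ℕ) = 0 ∧ (α y : ℕ) = 1
      · have := (α u).isLt
        rw [if_pos hα, if_pos hα, show (α u : ℕ) - 1 = 0 by omega, pow_zero, mul_one]
        exact pow_le_one₀ hz0.le hz1
      · rw [if_neg hα, if_neg hα]
    · intro α α' ⟨h1, h2⟩ ⟨h3, h4⟩
      ext v
      have := (α v).isLt
      rcases (show (α v : ℕ) = 0 ∨ (α v : ℕ) = 1 by omega) with h | h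
      · have : v = x := α.injective (Fin.ext (by omega))
        rw [this]
        omega
      · have : v = y := α.injective (Fin.ext (by omega))
        rw [this]
        omega
  | succ m ih =>
    intro V _ G hG hn x y u hxy h hx
    obtain ⟨hyu, w, hwx, hu, hdeg⟩ := path_step hG (by omega) hxy h hx
    have hux : u ≠ x := ne_of_leaf hx
    have hwu : w ≠ u := (show G.Adj u w from (hu w).2 (Or.inr rfl)).ne'
    set W : Set V := {x}ᶜ with hW
    have hxW : ∀ a, a ∈ W ↔ a ≠ x := fun a => by simp [hW]
    have hT' := isTree_remove hG hx
    have huW : u ∈ W := (hxW u).2 hux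
    have hwW : w ∈ W := (hxW w).2 hwx
    have hyW : y ∈ W := (hxW y).2 hxy.symm
    have key := ih hT' (card_compl_singleton hn x) (x := ⟨u, huW⟩) (y := ⟨y, hyW⟩)
      (u := ⟨w, hwW⟩) (by simpa [Subtype.ext_iff] using hyu.symm)
      (by
        rintro ⟨v, hv⟩ ⟨t, ht⟩ hvt
        rw [hxW] at hv
        by_cases hvu : v = u
        · left
          exact Subtype.ext hvu
        · right
          refine Subtype.ext ((h v t fun b => ?_).resolve_left hv)
          by_cases hb : b = x
          · subst hb
            refine ⟨fun hbv => absurd ((hx v).1 hbv.symm) hvu, ?_⟩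
            rintro rfl
            exact absurd rfl ((hxW _).1 ht)
          · simpa [Subtype.ext_iff] using hvt ⟨b, (hxW b).2 hb⟩)
      (by
        rintro ⟨b, hb⟩
        have := (hxW b).1 hb
        simp [hu b, this, Subtype.ext_iff])
    rw [← arrSum_comp (Equiv.equivCongr (Equiv.swap x u) (Equiv.refl _))]
    have hswap : ∀ (α : V ≃ Fin (m + 1 + 2)) (a : V),
        Equiv.equivCongr (Equiv.swap x u) (Equiv.refl _) α a = α (Equiv.swap x u a) :=
      fun α a => by simp [Equiv.equivCongr_apply_apply]
    simp only [hswap, Equiv.swap_apply_left, Equiv.swap_apply_right,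
      Equiv.swap_apply_of_ne_of_ne hxy.symm hyu]
    refine (arrSum_le_remove x _ (fun β s =>
      if ((β ⟨u, huW⟩ : ℕ) = 0 ∧ (β ⟨y, hyW⟩ : ℕ) = m + 1) ∧ s ≠ 0 then
        z ^ cost (G.induce W) (fun w => (β w : ℕ)) *
          (z ^ subdivisionCost (β ⟨w, hwW⟩) s * 1.1 ^ (s - 1)) else 0) ?_ ?_).trans ?_
    · intro β s
      split_ifs <;> positivity
    · intro α
      by_cases hα : (α u : ℕ) = 0 ∧ (α y : ℕ) = m + 1 + 1
      · have h1 := val_eq_remove x α ⟨u, huW⟩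
        have h2 := val_eq_remove x α ⟨y, hyW⟩
        have h3 := (remove x α ⟨y, hyW⟩).isLt
        have h4 : (α x : ℕ) ≠ 0 := fun h => hux (α.injective (Fin.ext (by omega)))
        have h5 : (remove x α ⟨u, huW⟩ : ℕ) = 0 := by
          dsimp only at h1
          split_ifs at h1 <;> omega
        have h6 : (remove x α ⟨y, hyW⟩ : ℕ) = m + 1 := by
          dsimp only at h2
          split_ifs at h2 <;> omega
        rw [if_pos hα, if_pos ⟨⟨h5, h6⟩, h4⟩, ← mul_assoc, ← pow_add]
        refine mul_le_mul_of_nonneg_right ?_ (by positivity)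
        exact pow_le_pow_of_le_one hz0.le hz1
          (cost_remove_end hG.connected hx hu hwW hxy.symm hyu hdeg α hα.1 hα.2)
      · rw [if_neg hα]
        split_ifs <;> positivity
    · refine le_trans (arrSum_mono (g := fun β => 1.085 *
        if (β ⟨u, huW⟩ : ℕ) = 0 ∧ (β ⟨y, hyW⟩ : ℕ) = m + 1 then
          z ^ cost (G.induce W) (fun w => (β w : ℕ)) * 1.1 ^ ((β ⟨w, hwW⟩ : ℕ) - 1) else 0)
        fun β => ?_) ?_
      · by_cases hβ : (β ⟨u, huW⟩ : ℕ) = 0 ∧ (β ⟨y, hyW⟩ : ℕ) = m + 1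
        · rw [sum_range_succ']
          simp only [hβ, ne_eq, not_true_eq_false, and_false, if_false, add_zero,
            and_self, Nat.add_eq_zero_iff, one_ne_zero, not_false_eq_true, if_true,
            Nat.add_sub_cancel]
          rw [← mul_sum]
          have hw0 : (β ⟨w, hwW⟩ : ℕ) ≠ 0 := fun h =>
            hwu (congrArg Subtype.val (β.injective (Fin.ext (h.trans hβ.1.symm))))
          obtain ⟨p, hp⟩ := Nat.exists_eq_succ_of_ne_zero hw0
          rw [hp, Nat.succ_eq_add_one, Nat.add_sub_cancel]
          have h1 := sum_subdivisionCost_le hz0 hz p (m + 1 + 1)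
          have h2 : 0 < z ^ cost (G.induce W) (fun w => (β w : ℕ)) := by positivity
          nlinarith
        · rw [if_neg hβ, mul_zero]
          exact (sum_eq_zero fun s _ => if_neg fun h => hβ h.1).le
      · rw [arrSum_mul]
        have hr0 : 0 < r ^ m := pow_pos (by linarith) m
        rw [pow_succ]
        nlinarith

lemma arrSum_two_ends_le {z r : ℝ} (hz0 : 0 < z) (hz : z ≤ 0.2571) (hr : 1.085 ≤ r) (m : ℕ) :
    ∀ {V : Type u} [Finite V] {G : SimpleGraph V} (_ : G.IsTree) (_ : Nat.card V = m + 2)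
      {x y : V} (_ : x ≠ y),
    arrSum V (m + 2) (fun α => if (α x : ℕ) = 0 ∧ (α y : ℕ) = m + 1 then
      z ^ cost G (fun w => (α w : ℕ)) else 0) ≤ r ^ (m + 2) := by
  have hz1 : z ≤ 1 := hz.trans (by norm_num)
  have hr1 : 1 ≤ r := le_trans (by norm_num) hr
  induction m with
  | zero =>
    intro V _ G hG hn x y hxy
    refine le_trans ?_ (one_le_pow₀ hr1)
    refine arrSum_le_one (fun α => (α x : ℕ) = 0 ∧ (α y : ℕ) = 1) (fun α => ?_) ?_
    · split_ifs
      · exact pow_le_one₀ hz0.le hz1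
      · exact le_rfl
    · intro α α' ⟨h1, h2⟩ ⟨h3, h4⟩
      ext v
      have := (α v).isLt
      rcases (show (α v : ℕ) = 0 ∨ (α v : ℕ) = 1 by omega) with h | h
      · have : v = x := α.injective (Fin.ext (by omega))
        rw [this]
        omega
      · have : v = y := α.injective (Fin.ext (by omega))
        rw [this]
        omega
  | succ m ih =>
    intro V _ G hG hn x y hxy
    by_cases h : ∀ v u, (∀ b, G.Adj v b ↔ b = u) → v = x ∨ v = y
    · have := Fintype.ofFinite V
      have : Nontrivial V := ⟨x, y, hxy⟩
      obtain ⟨u, hu, hu'⟩ := SimpleGraph.degree_eq_one_iff_existsUnique_adj.1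
        (degree_of_leaves hG hxy h).1
      refine le_trans (arrSum_mono fun α => ?_) ((arrSum_path_le hz0 hz hr (m + 1) hG hn hxy h
        (u := u) fun b => ⟨hu' b, by rintro rfl; exact hu⟩).trans
          (pow_le_pow_right₀ hr1 (by omega)))
      split_ifs
      · exact le_mul_of_one_le_right (by positivity) (one_le_pow₀ (by norm_num))
      · exact le_rfl
    · push Not at h
      obtain ⟨v, u, hl, hvx, hvy⟩ := h
      have huv : u ∈ ({v}ᶜ : Set V) := ne_of_leaf hl
      have hxW : x ∈ ({v}ᶜ : Set V) := hvx.symm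
      have hyW : y ∈ ({v}ᶜ : Set V) := hvy.symm
      refine (arrSum_le_remove_leaf hG.connected hl huv hz0 hz1
        (fun α => (α x : ℕ) = 0 ∧ (α y : ℕ) = m + 1 + 1)
        (fun β => (β ⟨x, hxW⟩ : ℕ) = 0 ∧ (β ⟨y, hyW⟩ : ℕ) = m + 1) 0 0 le_rfl le_rfl ?_).trans ?_
      · intro α hα
        have h1 := val_eq_remove v α ⟨x, hxW⟩
        have h2 := val_eq_remove v α ⟨y, hyW⟩
        have h3 := (remove v α ⟨y, hyW⟩).isLt
        have h4 : (α v : ℕ) ≠ 0 := fun h => hvx (α.injective (Fin.ext (by omega)))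
        have h5 : (α v : ℕ) ≠ m + 2 := fun h => hvy (α.injective (Fin.ext (by omega)))
        dsimp only at h1 h2
        refine ⟨⟨?_, ?_⟩, Or.inr h4, Or.inr h5⟩
        · split_ifs at h1 <;> omega
        · split_ifs at h2 <;> omega
      · refine (arrSum_mono fun β => ?_).trans ((ih (isTree_remove hG hl)
          (card_compl_singleton hn v) (x := ⟨x, hxW⟩) (y := ⟨y, hyW⟩)
          (by simpa using hxy)).trans (pow_le_pow_right₀ hr1 (by omega)))
        split_ifs
        · refine mul_le_of_le_one_right (by positivity) ?_
          have h1 := sum_pow_succ_le hz0 hz (β ⟨u, huv⟩)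
          have h2 := sum_pow_succ_le hz0 hz (m + 2 - 1 - β ⟨u, huv⟩)
          linarith
        · exact le_rfl

lemma arrSum_one_end_le {z r : ℝ} (hz0 : 0 < z) (hz : z ≤ 0.2571) (hr : 1.085 ≤ r) (m : ℕ) :
    ∀ {V : Type u} [Finite V] {G : SimpleGraph V} (_ : G.IsTree) (_ : Nat.card V = m + 1) (x : V),
    arrSum V (m + 1) (fun α => if (α x : ℕ) = 0 then
      z ^ cost G (fun w => (α w : ℕ)) else 0) ≤ 2.5 * r ^ (m + 1) := by
  have hz1 : z ≤ 1 := hz.trans (by norm_num)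
  have hr1 : 1 ≤ r := le_trans (by norm_num) hr
  induction m with
  | zero =>
    intro V _ G hG hn x
    have h1 : arrSum V (0 + 1) (fun α => if (α x : ℕ) = 0 then
        z ^ cost G (fun w => (α w : ℕ)) else 0) ≤ 1 := by
      refine arrSum_le_one (fun _ => True) (fun α => ?_) ?_
      · rw [if_pos trivial]
        split_ifs
        · exact pow_le_one₀ hz0.le hz1
        · exact zero_le_one
      · intro α α' _ _
        ext v
        omega
    rw [zero_add, pow_one] at *
    linarith
  | succ m ih =>
    intro V _ G hG hn x
    have : Nontrivial V := Finite.one_lt_card_iff_nontrivial.1 (by omega)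
    obtain ⟨v, u, hl, hvx⟩ : ∃ v u, (∀ b, G.Adj v b ↔ b = u) ∧ v ≠ x := by
      obtain ⟨v, u, v', u', hne, h1, h2⟩ := exists_two_leaves hG
      by_cases hv : v = x
      · exact ⟨v', u', h2, fun h => hne (hv.trans h.symm)⟩
      · exact ⟨v, u, h1, hv⟩
    have huv : u ∈ ({v}ᶜ : Set V) := ne_of_leaf hl
    have hxW : x ∈ ({v}ᶜ : Set V) := hvx.symm
    have hT' := isTree_remove hG hl
    have hn' := card_compl_singleton hn v
    have hB := ih hT' hn' ⟨x, hxW⟩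
    have hr0 : 0 < r ^ (m + 1) := by positivity
    refine (arrSum_le_remove_leaf hG.connected hl huv hz0 hz1
        (fun α => (α x : ℕ) = 0)
      (fun β => (β ⟨x, hxW⟩ : ℕ) = 0) 0 1 le_rfl zero_le_one ?_).trans ?_
    · intro α hα
      have h1 := val_eq_remove v α ⟨x, hxW⟩
      have h4 : (α v : ℕ) ≠ 0 := fun h => hvx (α.injective (Fin.ext (by omega)))
      dsimp only at h1
      refine ⟨?_, Or.inr h4, Or.inl le_rfl⟩
      split_ifs at h1 <;> omega
    · by_cases hux : u = x
      · subst hux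
        refine (arrSum_mono fun β => ?_).trans (hB.trans ?_)
        · split_ifs with h
          · refine mul_le_of_le_one_right (by positivity) ?_
            have := sum_pow_succ_add_le_one hz0 hz (m + 1 - 1 - β ⟨u, huv⟩)
            rw [h] at *
            simp only [range_zero, sum_empty, zero_mul, add_zero, zero_add, one_mul]
            exact this
          · exact le_rfl
        · rw [pow_succ _ (m + 1)]
          nlinarith
      · obtain ⟨k, rfl⟩ : ∃ k, m = k + 1 := by
          refine Nat.exists_eq_succ_of_ne_zero ?_
          rintro rfl
          have := Finite.card_le_one_iff_subsingleton (α := ({v}ᶜ : Set V))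
          have := (this.1 hn'.le).elim ⟨u, huv⟩ ⟨x, hxW⟩
          exact hux (congrArg Subtype.val this)
        have hC := arrSum_two_ends_le hz0 hz hr k hT' hn' (x := ⟨x, hxW⟩) (y := ⟨u, huv⟩)
          (by simpa using Ne.symm hux)
        refine (arrSum_mono (g := fun β => 0.862 * (if (β ⟨x, hxW⟩ : ℕ) = 0 then
          z ^ cost (G.induce {v}ᶜ) (fun w => (β w : ℕ)) else 0) +
          0.5 * (if (β ⟨x, hxW⟩ : ℕ) = 0 ∧ (β ⟨u, huv⟩ : ℕ) = k + 1 then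
          z ^ cost (G.induce {v}ᶜ) (fun w => (β w : ℕ)) else 0)) fun β => ?_).trans ?_
        · by_cases h : (β ⟨x, hxW⟩ : ℕ) = 0
          · simp only [h, if_true, true_and, zero_mul, add_zero, one_mul]
            have h0 : 0 < z ^ cost (G.induce {v}ᶜ) (fun w => (β w : ℕ)) := by positivity
            have h1 := sum_pow_succ_le hz0 hz (β ⟨u, huv⟩)
            have hlt := (β ⟨u, huv⟩).isLt
            split_ifs with h2
            · have := sum_pow_succ_add_le_one hz0 hz (k + 1 + 1 - 1 - β ⟨u, huv⟩)
              nlinarith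
            · have := sum_pow_succ_add_le_of_one_le hz0 hz
                (p := k + 1 + 1 - 1 - β ⟨u, huv⟩) (by omega)
              nlinarith
          · simp [h]
        · rw [arrSum_add, arrSum_mul, arrSum_mul, pow_succ _ (k + 1 + 1)]
          nlinarith

lemma arrSum_le_two_pow {z : ℝ} (hz0 : 0 < z) (hz : z ≤ 0.2571) (m : ℕ) :
    ∀ {V : Type u} [Finite V] {G : SimpleGraph V} (_ : G.IsTree) (_ : Nat.card V = m + 1),
    arrSum V (m + 1) (fun α => if True then z ^ cost G (fun w => (α w : ℕ)) else 0) ≤ 2 ^ m := by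
  have hz1 : z ≤ 1 := hz.trans (by norm_num)
  induction m with
  | zero =>
    intro V _ G hG hn
    rw [pow_zero]
    refine arrSum_le_one (fun _ => True) (fun α => ?_) ?_
    · rw [if_pos trivial, if_pos trivial]
      exact pow_le_one₀ hz0.le hz1
    · intro α α' _ _
      ext v
      omega
  | succ m ih =>
    intro V _ G hG hn
    have : Nontrivial V := Finite.one_lt_card_iff_nontrivial.1 (by omega)
    obtain ⟨v, u, -, -, -, hl, -⟩ := exists_two_leaves hG
    have huv : u ∈ ({v}ᶜ : Set V) := ne_of_leaf hl
    have hA := ih (isTree_remove hG hl) (card_compl_singleton hn v)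
    refine (arrSum_le_remove_leaf hG.connected hl huv hz0 hz1
        (fun _ => True)
      (fun _ => True) 1 1 zero_le_one zero_le_one fun _ _ =>
        ⟨trivial, Or.inl le_rfl, Or.inl le_rfl⟩).trans ?_
    rw [pow_succ, mul_comm]
    refine le_trans ?_ (mul_le_mul_of_nonneg_left hA zero_le_two)
    rw [← arrSum_mul]
    refine arrSum_mono fun β => ?_
    simp only [if_true, one_mul]
    have h0 : 0 < z ^ cost (G.induce {v}ᶜ) (fun w => (β w : ℕ)) := by positivity
    have h1 := sum_pow_succ_add_le_one hz0 hz (β ⟨u, huv⟩)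
    have h2 := sum_pow_succ_add_le_one hz0 hz (m + 1 - 1 - β ⟨u, huv⟩)
    nlinarith

lemma arrSum_le {z r : ℝ} (hz0 : 0 < z) (hz : z ≤ 0.2571) (hr : 1.085 ≤ r) (m : ℕ) :
    ∀ {V : Type u} [Finite V] {G : SimpleGraph V} (_ : G.IsTree) (_ : Nat.card V = m + 1),
    arrSum V (m + 1) (fun α => if True then z ^ cost G (fun w => (α w : ℕ)) else 0)
      ≤ 16 * r ^ (m + 1) := by
  have hz1 : z ≤ 1 := hz.trans (by norm_num)
  have hr1 : 1 ≤ r := le_trans (by norm_num) hr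
  induction m with
  | zero =>
    intro V _ G hG hn
    have := arrSum_le_two_pow hz0 hz 0 hG hn
    rw [zero_add, pow_one, pow_zero] at *
    linarith
  | succ m ih =>
    intro V _ G hG hn
    by_cases hm : m < 3
    · refine (arrSum_le_two_pow hz0 hz (m + 1) hG hn).trans ?_
      have h1 : (2 : ℝ) ^ (m + 1) ≤ 2 ^ 3 := pow_le_pow_right₀ one_le_two (by omega)
      have h2 : 1 ≤ r ^ (m + 1 + 1) := one_le_pow₀ hr1
      linarith
    have : Nontrivial V := Finite.one_lt_card_iff_nontrivial.1 (by omega)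
    obtain ⟨v, u, -, -, -, hl, -⟩ := exists_two_leaves hG
    have huv : u ∈ ({v}ᶜ : Set V) := ne_of_leaf hl
    have hT' := isTree_remove hG hl
    have hn' := card_compl_singleton hn v
    have hA := ih hT' hn'
    have hB := arrSum_one_end_le hz0 hz hr m hT' hn' ⟨u, huv⟩
    have hB' := hB
    rw [← arrSum_last_eq] at hB'
    have hr0 : 0 < r ^ (m + 1) := by positivity
    refine (arrSum_le_remove_leaf hG.connected hl huv hz0 hz1
        (fun _ => True)
      (fun _ => True) 1 1 zero_le_one zero_le_one fun _ _ =>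
        ⟨trivial, Or.inl le_rfl, Or.inl le_rfl⟩).trans ?_
    refine (arrSum_mono (g := fun β => 0.905 * (if True then
      z ^ cost (G.induce {v}ᶜ) (fun w => (β w : ℕ)) else 0) +
      (0.49 * (if (β ⟨u, huv⟩ : ℕ) = 0 then
        z ^ cost (G.induce {v}ᶜ) (fun w => (β w : ℕ)) else 0) +
      0.49 * (if (β ⟨u, huv⟩ : ℕ) = m then
        z ^ cost (G.induce {v}ᶜ) (fun w => (β w : ℕ)) else 0))) fun β => ?_).trans ?_
    · simp only [if_true, one_mul]
      have h0 : 0 < z ^ cost (G.induce {v}ᶜ) (fun w => (β w : ℕ)) := by positivity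
      have hlt := (β ⟨u, huv⟩).isLt
      obtain ⟨q, hq⟩ : ∃ q, q = m + 1 - 1 - β ⟨u, huv⟩ := ⟨_, rfl⟩
      rw [← hq]
      generalize (β ⟨u, huv⟩ : ℕ) = p at *
      have hp0 := sum_pow_succ_add_le_one hz0 hz p
      have hq0 := sum_pow_succ_add_le_one hz0 hz q
      by_cases hp : p = 0
      · have := sum_pow_succ_add_le_of_two_le hz0 hz (p := q) (by omega)
        rw [if_pos hp, if_neg (by omega)]
        nlinarith
      by_cases hpm : p = m
      · have := sum_pow_succ_add_le_of_two_le hz0 hz (p := p) (by omega)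
        rw [if_neg hp, if_pos hpm]
        nlinarith
      rw [if_neg hp, if_neg hpm]
      have hp1 := sum_pow_succ_add_le_of_one_le hz0 hz (p := p) (by omega)
      have hq1 := sum_pow_succ_add_le_of_one_le hz0 hz (p := q) (by omega)
      by_cases hp2 : 2 ≤ p
      · have := sum_pow_succ_add_le_of_two_le hz0 hz hp2
        nlinarith
      · have := sum_pow_succ_add_le_of_two_le hz0 hz (p := q) (by omega)
        nlinarith
    · rw [arrSum_add, arrSum_add, arrSum_mul, arrSum_mul, arrSum_mul, pow_succ _ (m + 1)]
      nlinarith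


lemma card_mul_pow_le {V : Type*} [Finite V] (G : SimpleGraph V) (k : ℕ)
    (P : (V ≃ Fin (Nat.card V)) → Prop) {z : ℝ} (hz0 : 0 < z) (hz1 : z ≤ 1) :
    (Nat.card {α : V ≃ Fin (Nat.card V) // netCost G (arr α) ≤ k ∧ P α} : ℝ) * z ^ k ≤
      arrSum V (Nat.card V) (fun α => if P α then z ^ cost G (fun w => (α w : ℕ)) else 0) := by
  have := Fintype.ofFinite (V ≃ Fin (Nat.card V))
  rw [arrSum_eq, Nat.card_eq_fintype_card, Fintype.card_subtype, ← nsmul_eq_mul, ← sum_const,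
    sum_filter]
  refine sum_le_sum fun α _ => ?_
  by_cases hP : P α
  · rw [if_pos hP]
    split_ifs with h
    · exact pow_le_pow_of_le_one hz0.le hz1 ((cost_le_netCost G α).trans h.1)
    · positivity
  · rw [if_neg hP, if_neg fun h => hP h.2]

lemma card_mul_pow_le_of_isTree {V : Type*} [Finite V] {T : SimpleGraph V} (hT : T.IsTree)
    (hn : 2 ≤ Nat.card V) (k : ℕ) {X : Set V} (hX : Nat.card X ≤ 3) {z r c : ℝ} (hz0 : 0 < z)
    (hz : z ≤ 0.2571) (hr : 1.085 ≤ r) (hc : 0 ≤ c) (h₀ : Nat.card X = 0 → 16 ≤ c)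
    (h₁ : Nat.card X = 1 → 5 ≤ c) (h₂ : Nat.card X = 2 → 2 ≤ c) :
    (Nat.card {α : V ≃ Fin (Nat.card V) //
        netCost T (arr α) ≤ k ∧ ∀ x ∈ X, arr α x = 1 ∨ arr α x = Nat.card V} : ℝ) * z ^ k ≤
      c * r ^ Nat.card V := by
  have hz1 : z ≤ 1 := hz.trans (by norm_num)
  have hr0 : 0 < r ^ Nat.card V := pow_pos (by linarith) _
  obtain ⟨m, hm⟩ : ∃ m, Nat.card V = m + 2 := ⟨_, (Nat.sub_add_cancel hn).symm⟩
  refine (card_mul_pow_le T k (fun α => ∀ x ∈ X, arr α x = 1 ∨ arr α x = Nat.card V)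
    hz0 hz1).trans ((arrSum_mono (g := fun α =>
      if ∀ x ∈ X, (α x : ℕ) = 0 ∨ (α x : ℕ) + 1 = Nat.card V then
        z ^ cost T (fun w => (α w : ℕ)) else 0)
      fun α => (if_congr (by simp [arr]) rfl rfl).le).trans ?_)
  rw [Nat.card_coe_set_eq] at *
  rw [hm] at hr0 ⊢
  obtain h | h | h | h : X.ncard = 0 ∨ X.ncard = 1 ∨ X.ncard = 2 ∨ X.ncard = 3 := by omega
  · have h3 := arrSum_le hz0 hz hr (m + 1) hT hm
    refine (arrSum_mono fun α => ?_).trans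
      (h3.trans (mul_le_mul_of_nonneg_right (h₀ h) hr0.le))
    rw [if_pos trivial]
    split_ifs
    · exact le_rfl
    · positivity
  · obtain ⟨x, rfl⟩ := Set.ncard_eq_one.1 h
    have h3 := arrSum_one_end_le hz0 hz hr (m + 1) hT hm x
    have h4 := h3
    rw [← arrSum_last_eq] at h4
    refine (arrSum_mono (g := fun α => (if (α x : ℕ) = 0 then z ^ cost T (fun w => (α w : ℕ))
      else 0) + if (α x : ℕ) = m + 1 then z ^ cost T (fun w => (α w : ℕ)) else 0)
      fun α => ?_).trans ?_
    · have h0 : 0 < z ^ cost T (fun w => (α w : ℕ)) := by positivity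
      simp only [Set.mem_singleton_iff, forall_eq]
      split_ifs <;> first | omega | linarith
    · rw [arrSum_add]
      have := h₁ h
      nlinarith
  · obtain ⟨x, y, hxy, rfl⟩ := Set.ncard_eq_two.1 h
    have h3 := arrSum_two_ends_le hz0 hz hr m hT hm hxy
    have h4 := arrSum_two_ends_le hz0 hz hr m hT hm hxy.symm
    refine (arrSum_mono (g := fun α => (if (α x : ℕ) = 0 ∧ (α y : ℕ) = m + 1 then
      z ^ cost T (fun w => (α w : ℕ)) else 0) + if (α y : ℕ) = 0 ∧ (α x : ℕ) = m + 1 then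
      z ^ cost T (fun w => (α w : ℕ)) else 0) fun α => ?_).trans ?_
    · have h0 : 0 < z ^ cost T (fun w => (α w : ℕ)) := by positivity
      have hne : (α x : ℕ) ≠ α y := fun h => hxy (α.injective (Fin.ext h))
      simp only [Set.mem_insert_iff, Set.mem_singleton_iff, forall_eq_or_imp, forall_eq]
      split_ifs <;> first | omega | linarith
    · rw [arrSum_add]
      have := h₂ h
      nlinarith
  · obtain ⟨x, y, w, hxy, hxw, hyw, rfl⟩ := Set.ncard_eq_three.1 h
    refine (arrSum_mono (g := fun α => 0 * z ^ cost T (fun w => (α w : ℕ))) fun α => ?_).trans ?_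
    · have h5 : (α x : ℕ) ≠ α y := fun h => hxy (α.injective (Fin.ext h))
      have h6 : (α x : ℕ) ≠ α w := fun h => hxw (α.injective (Fin.ext h))
      have h7 : (α y : ℕ) ≠ α w := fun h => hyw (α.injective (Fin.ext h))
      simp only [Set.mem_insert_iff, Set.mem_singleton_iff, forall_eq_or_imp, forall_eq]
      rw [if_neg (by omega), zero_mul]
    · rw [arrSum_mul, zero_mul]
      positivity

lemma two_rpow_neg_le : (2 : ℝ) ^ (-1.96 : ℝ) ≤ 0.2571 := by
  refine le_of_pow_le_pow_left₀ (n := 25) (by norm_num) (by norm_num) ?_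
  rw [← Real.rpow_natCast, ← Real.rpow_mul zero_le_two,
    show (-1.96 : ℝ) * (25 : ℕ) = -(49 : ℕ) by norm_num, Real.rpow_neg zero_le_two,
    Real.rpow_natCast]
  norm_num

lemma le_two_rpow : 1.085 ≤ (2 : ℝ) ^ (0.119 : ℝ) := by
  refine le_trans (b := (2 : ℝ) ^ (7 / 59 : ℝ)) ?_
    (Real.rpow_le_rpow_of_exponent_le one_le_two (by norm_num))
  refine le_of_pow_le_pow_left₀ (n := 59) (by norm_num) (by positivity) ?_
  rw [← Real.rpow_natCast ((2 : ℝ) ^ (7 / 59 : ℝ)), ← Real.rpow_mul zero_le_two,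
    show (7 / 59 : ℝ) * (59 : ℕ) = (7 : ℕ) by norm_num, Real.rpow_natCast]
  norm_num

end

end TreeArrangement

theorem tree_arrangement_count_bound {V : Type*} [Finite V] (T : SimpleGraph V)
    (hT : T.Connected) (hacyclic : T.IsAcyclic) (hn : 2 ≤ Nat.card V)
    (k : ℕ) (X : Set V) (hX : Nat.card X ≤ 3) :
    (Nat.card {α : V ≃ Fin (Nat.card V) //
        netCost T (arr α) ≤ k ∧ ∀ x ∈ X, arr α x = 1 ∨ arr α x = Nat.card V} : ℝ) ≤
      2 ^ ((0.119 : ℝ) * Nat.card V + 1.96 * k - 1.4625 * Nat.card X + 4) := by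
  have hz0 : (0 : ℝ) < 2 ^ (-1.96 : ℝ) := by positivity
  have hexp : (2 : ℝ) ^ ((0.119 : ℝ) * Nat.card V + 1.96 * k - 1.4625 * Nat.card X + 4) =
      (2 : ℝ) ^ (4 - 1.4625 * Nat.card X : ℝ) * ((2 : ℝ) ^ (0.119 : ℝ)) ^ Nat.card V /
        ((2 : ℝ) ^ (-1.96 : ℝ)) ^ k := by
    rw [← Real.rpow_natCast, ← Real.rpow_natCast _ k, ← Real.rpow_mul zero_le_two,
      ← Real.rpow_mul zero_le_two, ← Real.rpow_add zero_lt_two, ← Real.rpow_sub zero_lt_two]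
    congr 1
    ring
  rw [hexp, le_div_iff₀ (pow_pos hz0 k)]
  refine TreeArrangement.card_mul_pow_le_of_isTree ⟨hT, hacyclic⟩ hn k hX hz0
    TreeArrangement.two_rpow_neg_le TreeArrangement.le_two_rpow (by positivity) ?_ ?_ ?_
  · intro h
    rw [h, show (4 - 1.4625 * (0 : ℕ) : ℝ) = (4 : ℕ) by norm_num, Real.rpow_natCast]
    norm_num
  · intro h
    refine le_trans (b := (2 : ℝ) ^ (5 / 2 : ℝ)) ?_
      (Real.rpow_le_rpow_of_exponent_le one_le_two (by rw [h]; norm_num))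
    refine le_of_pow_le_pow_left₀ (n := 2) (by norm_num) (by positivity) ?_
    rw [← Real.rpow_natCast ((2 : ℝ) ^ (5 / 2 : ℝ)), ← Real.rpow_mul zero_le_two,
      show (5 / 2 : ℝ) * (2 : ℕ) = (5 : ℕ) by norm_num, Real.rpow_natCast]
    norm_num
  · intro h
    exact Real.self_le_rpow_of_one_le one_le_two (by rw [h]; norm_num)
end
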